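/- arXiv:1101.3596 — 2 statements merged into one kernel-verified Lean document; each statement's English description precedes it below -/
import Mathlib

section
/- For every δ ∈ (0,1) there exists a set A ⊆ ℝ² such that A ∈ R(w,ρ,fine;1) (and hence A ∈ R(w,∅,fine;1) and A ∈ R(w,β,γ;1) for every β ∈ {∅,ρ} and γ ∈ (0,1)), A ∈ R(w,ρ0,δ;1), and yet P^1(A) ≠ H^1(A); i.e. the weak Reifenberg properties without ρ0-uniform fineness do not force the packing and Hausdorff measures to agree. -/
open Metric Set MeasureTheory ENNReal NNReal

attribute [local instance] Classical.propDecidable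

noncomputable section

namespace ReifenbergPaper

/-- The closed `r`-neighbourhood `E^r = {x : dist (x, E) ≤ r}` of `E ⊆ ℝⁿ`. -/
def nbhd {n : ℕ} (E : Set (EuclideanSpace ℝ (Fin n))) (r : ℝ) :
    Set (EuclideanSpace ℝ (Fin n)) :=
  {x | Metric.infDist x E ≤ r}

/-- The affine plane through `x` with direction the linear subspace `W`. -/
def affPlane {n : ℕ} (x : EuclideanSpace ℝ (Fin n))
    (W : Submodule ℝ (EuclideanSpace ℝ (Fin n))) : Set (EuclideanSpace ℝ (Fin n)) :=
  {z | z - x ∈ W}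

/-- `A ∈ R(w,∅,δ;j)`. -/
def RwEmpty {n : ℕ} (j : ℕ) (δ : ℝ) (A : Set (EuclideanSpace ℝ (Fin n))) : Prop :=
  ∀ y ∈ A, ∃ ρy > (0:ℝ), ∀ ρ ∈ Set.Ioc (0:ℝ) ρy,
    ∃ W : Submodule ℝ (EuclideanSpace ℝ (Fin n)), Module.finrank ℝ W = j ∧
      Metric.closedBall y ρ ∩ A ⊆ nbhd (affPlane y W) (δ * ρ)

/-- `A ∈ R(w,ρ,δ;j)`. -/
def RwRho {n : ℕ} (j : ℕ) (δ : ℝ) (A : Set (EuclideanSpace ℝ (Fin n))) : Prop :=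
  ∀ y ∈ A, ∃ ρy > (0:ℝ), ∀ x ∈ Metric.closedBall y ρy ∩ A, ∀ ρ ∈ Set.Ioc (0:ℝ) ρy,
    ∃ W : Submodule ℝ (EuclideanSpace ℝ (Fin n)), Module.finrank ℝ W = j ∧
      Metric.closedBall x ρ ∩ A ⊆ nbhd (affPlane x W) (δ * ρ)

/-- `A ∈ R(w,ρ0,δ;j)`. -/
def RwRho0 {n : ℕ} (j : ℕ) (δ : ℝ) (A : Set (EuclideanSpace ℝ (Fin n))) : Prop :=
  ∃ ρ0 > (0:ℝ), (∃ c, A ⊆ Metric.closedBall c ρ0) ∧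
    ∀ y ∈ A, ∀ ρ ∈ Set.Ioc (0:ℝ) ρ0,
      ∃ W : Submodule ℝ (EuclideanSpace ℝ (Fin n)), Module.finrank ℝ W = j ∧
        Metric.closedBall y ρ ∩ A ⊆ nbhd (affPlane y W) (δ * ρ)

/-- `A ∈ R(s,∅,δ;j)`. -/
def RsEmpty {n : ℕ} (j : ℕ) (δ : ℝ) (A : Set (EuclideanSpace ℝ (Fin n))) : Prop :=
  ∀ y ∈ A, ∃ ρy > (0:ℝ), ∃ W : Submodule ℝ (EuclideanSpace ℝ (Fin n)),
    Module.finrank ℝ W = j ∧ ∀ ρ ∈ Set.Ioc (0:ℝ) ρy,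
      Metric.closedBall y ρ ∩ A ⊆ nbhd (affPlane y W) (δ * ρ)

/-- `A ∈ R(s,ρ,δ;j)`. -/
def RsRho {n : ℕ} (j : ℕ) (δ : ℝ) (A : Set (EuclideanSpace ℝ (Fin n))) : Prop :=
  ∀ y ∈ A, ∃ ρy > (0:ℝ), ∃ W : Submodule ℝ (EuclideanSpace ℝ (Fin n)),
    Module.finrank ℝ W = j ∧
    ∀ x ∈ Metric.closedBall y ρy ∩ A, ∀ ρ ∈ Set.Ioc (0:ℝ) ρy,
      Metric.closedBall x ρ ∩ A ⊆ nbhd (affPlane x W) (δ * ρ)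

/-- `A ∈ R(s,ρ0,δ;j)`. -/
def RsRho0 {n : ℕ} (j : ℕ) (δ : ℝ) (A : Set (EuclideanSpace ℝ (Fin n))) : Prop :=
  ∃ ρ0 > (0:ℝ), (∃ c, A ⊆ Metric.closedBall c ρ0) ∧
    ∃ W : Submodule ℝ (EuclideanSpace ℝ (Fin n)), Module.finrank ℝ W = j ∧
      ∀ x ∈ A, ∀ ρ ∈ Set.Ioc (0:ℝ) ρ0,
        Metric.closedBall x ρ ∩ A ⊆ nbhd (affPlane x W) (δ * ρ)

/-- The weak/strong parameter `α`. -/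
inductive Alpha | w | s

/-- The uniformity parameter `β ∈ {∅, ρ, ρ0}`. -/
inductive Beta | none | rho | rho0

/-- `A ∈ R(α,β,δ;j)` for a fixed approximation constant `δ`. -/
def RDelta {n : ℕ} (α : Alpha) (β : Beta) (j : ℕ) (δ : ℝ)
    (A : Set (EuclideanSpace ℝ (Fin n))) : Prop :=
  match α, β with
  | .w, .none => RwEmpty j δ A
  | .w, .rho  => RwRho j δ A
  | .w, .rho0 => RwRho0 j δ A
  | .s, .none => RsEmpty j δ A
  | .s, .rho  => RsRho j δ A
  | .s, .rho0 => RsRho0 j δ A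

/-- `A ∈ R(α,β,γ;j)` where `γ : Option ℝ`, with `Option.none` denoting the fine
property (`δ`-approximation for every `δ ∈ (0,1)`) and `Option.some δ` denoting the
`δ`-approximation property. -/
def RGamma {n : ℕ} (α : Alpha) (β : Beta) (j : ℕ) (γ : Option ℝ)
    (A : Set (EuclideanSpace ℝ (Fin n))) : Prop :=
  match γ with
  | Option.none => ∀ δ ∈ Set.Ioo (0:ℝ) 1, RDelta α β j δ A
  | Option.some δ => RDelta α β j δ A

/-- `γ ∈ Δ := {fine} ∪ (0,1)`. -/
def memDelta (γ : Option ℝ) : Prop :=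
  γ = Option.none ∨ ∃ d ∈ Set.Ioo (0:ℝ) 1, γ = Option.some d

/-- The graph `{x + g x : x ∈ W}` of a function `g : W → Wᗮ`. -/
def lipGraph {n : ℕ} (W : Submodule ℝ (EuclideanSpace ℝ (Fin n)))
    (g : W → Wᗮ) : Set (EuclideanSpace ℝ (Fin n)) :=
  {p | ∃ x : W, p = (x : EuclideanSpace ℝ (Fin n)) + (g x : EuclideanSpace ℝ (Fin n))}

/-- `N_ε(E)`: the smallest number of sets of diameter at most `ε` needed to cover `E`,
as an element of `ℝ≥0∞` (`⊤` if no finite cover exists). -/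
def coverNum {n : ℕ} (E : Set (EuclideanSpace ℝ (Fin n))) (ε : ℝ) : ℝ≥0∞ :=
  ⨅ (s : Finset (Set (EuclideanSpace ℝ (Fin n)))) (_ : E ⊆ ⋃ t ∈ s, t)
    (_ : ∀ t ∈ s, Metric.diam t ≤ ε), (s.card : ℝ≥0∞)

/-- Upper Minkowski (box-counting) dimension
`limsup_{ε → 0⁺} log N_ε(E) / (- log ε)`, with the convention that the empty set
has dimension `0`. -/
def upperMinkDim {n : ℕ} (E : Set (EuclideanSpace ℝ (Fin n))) : ℝ :=
  if E = ∅ then 0 else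
    Filter.limsup (fun ε : ℝ => Real.log (coverNum E ε).toReal / (-Real.log ε))
      (nhdsWithin 0 (Set.Ioi 0))

/-- Lower Minkowski (box-counting) dimension
`liminf_{ε → 0⁺} log N_ε(E) / (- log ε)`, with the convention that the empty set
has dimension `0`. -/
def lowerMinkDim {n : ℕ} (E : Set (EuclideanSpace ℝ (Fin n))) : ℝ :=
  if E = ∅ then 0 else
    Filter.liminf (fun ε : ℝ => Real.log (coverNum E ε).toReal / (-Real.log ε))
      (nhdsWithin 0 (Set.Ioi 0))

/-- Packing dimension:
`dim_P A = inf { sup_i dim̄_M A_i : A = ⋃ i, A_i, each A_i bounded }`. -/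
def packDim {n : ℕ} (A : Set (EuclideanSpace ℝ (Fin n))) : ℝ :=
  sInf {d : ℝ | ∃ F : ℕ → Set (EuclideanSpace ℝ (Fin n)),
    A = ⋃ i, F i ∧ (∀ i, Bornology.IsBounded (F i)) ∧ ∀ i, upperMinkDim (F i) ≤ d}

/-- `D` is an `η`-packing of `E`: a countable collection of pairwise disjoint closed
balls centred at points of `E` with (positive) radii at most `η`, coded as a set of
(centre, radius) pairs. -/
def IsPacking {n : ℕ} (η : ℝ) (E : Set (EuclideanSpace ℝ (Fin n)))
    (D : Set (EuclideanSpace ℝ (Fin n) × ℝ)) : Prop :=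
  D.Countable ∧ (∀ p ∈ D, p.1 ∈ E ∧ 0 < p.2 ∧ p.2 ≤ η) ∧
    D.Pairwise fun p q => Disjoint (Metric.closedBall p.1 p.2) (Metric.closedBall q.1 q.2)

/-- The packing premeasure `P^s_η(E) = sup { Σ_i (diam B_i)^s }` over `η`-packings. -/
def packPre {n : ℕ} (s : ℕ) (η : ℝ) (E : Set (EuclideanSpace ℝ (Fin n))) : ℝ≥0∞ :=
  ⨆ (D : Set (EuclideanSpace ℝ (Fin n) × ℝ)) (_ : IsPacking η E D),
    ∑' p : D, (ENNReal.ofReal (Metric.diam (Metric.closedBall p.1.1 p.1.2))) ^ s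

/-- `P^s_0(E) = lim_{η ↓ 0} P^s_η(E) = inf_{η > 0} P^s_η(E)`. -/
def packPre0 {n : ℕ} (s : ℕ) (E : Set (EuclideanSpace ℝ (Fin n))) : ℝ≥0∞ :=
  ⨅ (η : ℝ) (_ : 0 < η), packPre s η E

/-- The `s`-dimensional packing measure
`P^s(E) = inf { Σ_i P^s_0(E_i) : E ⊆ ⋃ i, E_i }`. -/
def packMeasure {n : ℕ} (s : ℕ) (E : Set (EuclideanSpace ℝ (Fin n))) : ℝ≥0∞ :=
  ⨅ (F : ℕ → Set (EuclideanSpace ℝ (Fin n))) (_ : E ⊆ ⋃ i, F i), ∑' i, packPre0 s (F i)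

/-- `A` is `(μ, j)`-rectifiable: `A ⊆ M₀ ∪ ⋃ i, f i '' ℝ^j` with `μ M₀ = 0` and each
`f i` Lipschitz. -/
def Rectifiable {n : ℕ} (μ : Set (EuclideanSpace ℝ (Fin n)) → ℝ≥0∞) (j : ℕ)
    (A : Set (EuclideanSpace ℝ (Fin n))) : Prop :=
  ∃ (M₀ : Set (EuclideanSpace ℝ (Fin n)))
    (f : ℕ → EuclideanSpace ℝ (Fin j) → EuclideanSpace ℝ (Fin n)),
    μ M₀ = 0 ∧ (∀ i, ∃ K : ℝ≥0, LipschitzWith K (f i)) ∧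
      A ⊆ M₀ ∪ ⋃ i, Set.range (f i)

/-- `A` has weakly locally finite `μ` measure. -/
def WeaklyLocFinite {n : ℕ} (μ : Set (EuclideanSpace ℝ (Fin n)) → ℝ≥0∞)
    (A : Set (EuclideanSpace ℝ (Fin n))) : Prop :=
  ∀ y ∈ A, ∃ ρ > (0:ℝ), μ (Metric.closedBall y ρ ∩ A) < ⊤

/-- `A` has strongly locally finite `μ` measure. -/
def StronglyLocFinite {n : ℕ} (μ : Set (EuclideanSpace ℝ (Fin n)) → ℝ≥0∞)
    (A : Set (EuclideanSpace ℝ (Fin n))) : Prop :=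
  ∀ K : Set (EuclideanSpace ℝ (Fin n)), IsCompact K → μ (K ∩ A) < ⊤

/-- `A` satisfies the two-sided `wρ j` property with respect to `ε`. -/
def TwoSidedWRho {n : ℕ} (j : ℕ) (ε : ℝ) (A : Set (EuclideanSpace ℝ (Fin n))) : Prop :=
  ∀ y ∈ A, ∃ ρy > (0:ℝ), ∀ x ∈ A ∩ Metric.closedBall y ρy, ∀ ρ ∈ Set.Ioc (0:ℝ) ρy,
    ∃ (x0 : EuclideanSpace ℝ (Fin n)) (W : Submodule ℝ (EuclideanSpace ℝ (Fin n))),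
      Module.finrank ℝ W = j ∧
      Metric.hausdorffDist (A ∩ Metric.closedBall x ρ)
        (affPlane x0 W ∩ Metric.closedBall x ρ) < ε * ρ

/-- The set `N_j = ⋃_{i ≥ 1} {i⁻¹} × [0,1]^j ⊆ ℝ^{j+1}`. -/
def NSet (j : ℕ) : Set (EuclideanSpace ℝ (Fin (j+1))) :=
  {x | ∃ i : ℕ, 1 ≤ i ∧ x 0 = ((i : ℝ))⁻¹ ∧ ∀ k : Fin (j+1), k ≠ 0 → x k ∈ Set.Icc (0:ℝ) 1}


/-- The triangle wave. -/
noncomputable def tri (x : ℝ) : ℝ := (-1 : ℝ) ^ round x * (x - round x)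

lemma abs_neg_one_zpow_int (m : ℤ) : |(-1 : ℝ) ^ m| = 1 := by simp [abs_zpow]

lemma abs_tri_le (x : ℝ) : |tri x| ≤ 1 / 2 := by
  rw [tri, abs_mul, abs_neg_one_zpow_int, one_mul]
  exact abs_sub_round x

lemma round_bounds (x : ℝ) : (round x : ℝ) ≤ x + 1 / 2 ∧ x < round x + 1 / 2 := by
  rw [round_eq]
  exact ⟨Int.floor_le _, by linarith [Int.lt_floor_add_one (x + 1 / 2)]⟩

lemma tri_eq_of_abs_sub_le {x : ℝ} {m : ℤ} (h : |x - m| ≤ 1 / 2) :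
    tri x = (-1 : ℝ) ^ m * (x - m) := by
  obtain ⟨h1, h2⟩ := abs_le.1 h
  obtain ⟨h3, h4⟩ := round_bounds x
  have h5 : m ≤ round x := by
    have : (m : ℝ) < round x + 1 := by linarith
    exact Int.lt_add_one_iff.1 (by exact_mod_cast this)
  have h6 : round x ≤ m + 1 := by
    have : (round x : ℝ) ≤ m + 1 := by linarith
    exact_mod_cast this
  rcases h5.eq_or_lt with h | h
  · rw [tri, ← h]
  · have h7 : round x = m + 1 := by omega
    have h8 : x = m + 1 / 2 := by
      rw [h7] at h3
      push_cast at h3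
      linarith
    rw [tri, h7, zpow_add_one₀ (by norm_num)]
    push_cast
    rw [h8]
    ring

lemma tri_intCast (m : ℤ) : tri m = 0 := by
  rw [tri_eq_of_abs_sub_le (m := m) (by simp)]
  simp

lemma abs_tri_sub_le (x y : ℝ) : |tri x - tri y| ≤ |x - y| := by
  wlog hxy : x ≤ y generalizing x y
  · rw [abs_sub_comm, abs_sub_comm x]
    exact this y x (le_of_not_ge hxy)
  have hr : round x ≤ round y := by
    rw [round_eq, round_eq]
    exact Int.floor_le_floor (by linarith)
  obtain ⟨h1, h2⟩ := round_bounds x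
  obtain ⟨h3, h4⟩ := round_bounds y
  rw [abs_sub_comm x, abs_of_nonneg (by linarith : (0 : ℝ) ≤ y - x)]
  rcases hr.eq_or_lt with h | h
  · rw [tri, tri, h, ← mul_sub, abs_mul, abs_neg_one_zpow_int, one_mul]
    exact abs_le.2 ⟨by linarith, by linarith⟩
  rcases (Int.add_one_le_iff.2 h).eq_or_lt with h' | h'
  · rw [← h'] at h3 h4
    push_cast at h3 h4
    have : tri x - tri y = (-1 : ℝ) ^ round x * (x + y - 2 * round x - 1) := by
      rw [tri, tri, ← h', zpow_add_one₀ (by norm_num)]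
      push_cast
      ring
    rw [this, abs_mul, abs_neg_one_zpow_int, one_mul]
    exact abs_le.2 ⟨by linarith, by linarith⟩
  · have h5 : ((round x + 2 : ℤ) : ℝ) ≤ round y := by
      exact_mod_cast (by omega : round x + 2 ≤ round y)
    push_cast at h5
    have := abs_le.1 (abs_tri_le x)
    have := abs_le.1 (abs_tri_le y)
    exact abs_le.2 ⟨by linarith, by linarith⟩

lemma continuous_tri : Continuous tri :=
  (LipschitzWith.of_dist_le_mul (K := 1) fun x y => by
    simpa [Real.dist_eq] using abs_tri_sub_le x y).continuous

lemma exists_half_integer_between {x y : ℝ} (h : round x ≠ round y) :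
    ∃ i : ℤ, (i : ℝ) + 1 / 2 ∈ uIcc x y := by
  wlog hxy : round x < round y generalizing x y
  · rw [uIcc_comm]
    exact this h.symm (lt_of_le_of_ne (not_lt.1 hxy) h.symm)
  refine ⟨round x, ?_⟩
  obtain ⟨h1, h2⟩ := round_bounds x
  obtain ⟨h3, h4⟩ := round_bounds y
  have h5 : ((round x + 1 : ℤ) : ℝ) ≤ round y := by exact_mod_cast hxy
  push_cast at h5
  exact mem_uIcc.2 (Or.inl ⟨by linarith, by linarith⟩)

lemma inv_two_pow_le_of_round_ne {x y : ℝ} {k l : ℕ} (hkl : k < l)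
    (hk : round (2 ^ k * x) ≠ round (2 ^ k * y)) (hl : round (2 ^ l * x) ≠ round (2 ^ l * y)) :
    ((2 : ℝ) ^ (l + 1))⁻¹ ≤ |y - x| := by
  have key : ∀ k : ℕ, round (2 ^ k * x) ≠ round (2 ^ k * y) →
      ∃ i : ℤ, (2 * i + 1 : ℝ) / 2 ^ (k + 1) ∈ uIcc x y := by
    intro k hk
    obtain ⟨i, hi⟩ := exists_half_integer_between hk
    refine ⟨i, ?_⟩
    have hp : (0 : ℝ) < 2 ^ k := by positivity
    have e : (2 * i + 1 : ℝ) / 2 ^ (k + 1) = (i + 1 / 2) / 2 ^ k := by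
      rw [pow_succ]; field_simp
    rw [e]
    rcases mem_uIcc.1 hi with ⟨h1, h2⟩ | ⟨h1, h2⟩
    · exact mem_uIcc.2 (Or.inl ⟨by rw [le_div_iff₀ hp]; linarith, by rw [div_le_iff₀ hp]; linarith⟩)
    · exact mem_uIcc.2 (Or.inr ⟨by rw [le_div_iff₀ hp]; linarith, by rw [div_le_iff₀ hp]; linarith⟩)
  obtain ⟨i, hi⟩ := key k hk
  obtain ⟨j, hj⟩ := key l hl
  refine le_trans ?_ (abs_sub_le_of_uIcc_subset_uIcc (uIcc_subset_uIcc hi hj))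
  obtain ⟨d, rfl⟩ := Nat.exists_eq_add_of_lt hkl
  have hne : (2 * j + 1) - (2 * i + 1) * 2 ^ (d + 1) ≠ (0 : ℤ) := by
    rw [pow_succ]
    intro h
    have : 2 * (j - (2 * i + 1) * 2 ^ d) = -1 := by linarith
    omega
  have h1 : (1 : ℝ) ≤ |(2 * (j : ℝ) + 1) - (2 * i + 1) * 2 ^ (d + 1)| := by
    exact_mod_cast Int.one_le_abs hne
  have e : (2 * j + 1 : ℝ) / 2 ^ (k + d + 1 + 1) - (2 * i + 1) / 2 ^ (k + 1)
      = ((2 * j + 1) - (2 * i + 1) * 2 ^ (d + 1)) * (2 ^ (k + d + 1 + 1))⁻¹ := by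
    have : (2 : ℝ) ^ (k + d + 1 + 1) = 2 ^ (k + 1) * 2 ^ (d + 1) := by ring
    rw [this]; field_simp
  rw [e, abs_mul, abs_of_pos (by positivity : (0 : ℝ) < (2 ^ (k + d + 1 + 1))⁻¹)]
  exact le_mul_of_one_le_left (by positivity) h1

lemma tri_midpoint (p : ℕ) (i : ℤ) :
    tri ((2 * i + 1) / 2 ^ (p + 2)) =
      (tri (i / 2 ^ (p + 1)) + tri ((i + 1) / 2 ^ (p + 1))) / 2 := by
  set m : ℤ := (i + 2 ^ p) / 2 ^ (p + 1) with hm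
  have hp : (0 : ℤ) < 2 ^ (p + 1) := by positivity
  have h1 : m * 2 ^ (p + 1) ≤ i + 2 ^ p := Int.ediv_mul_le _ hp.ne'
  have h2 : i + 2 ^ p + 1 ≤ (m + 1) * 2 ^ (p + 1) := Int.lt_ediv_add_one_mul_self _ hp
  have h1' : (m : ℝ) * 2 ^ (p + 1) ≤ i + 2 ^ p := by exact_mod_cast h1
  have h2' : (i : ℝ) + 2 ^ p + 1 ≤ (m + 1) * 2 ^ (p + 1) := by exact_mod_cast h2
  have hq : (0 : ℝ) < 2 ^ (p + 1) := by positivity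
  have hpp : (2 : ℝ) ^ (p + 1) = 2 ^ p * 2 := pow_succ _ _
  have hA : |(i : ℝ) / 2 ^ (p + 1) - m| ≤ 1 / 2 := by
    rw [abs_le]
    constructor
    · rw [le_sub_iff_add_le, le_div_iff₀ hq]; linarith
    · rw [sub_le_iff_le_add, div_le_iff₀ hq]; linarith
  have hB : |((i : ℝ) + 1) / 2 ^ (p + 1) - m| ≤ 1 / 2 := by
    rw [abs_le]
    constructor
    · rw [le_sub_iff_add_le, le_div_iff₀ hq]; linarith
    · rw [sub_le_iff_le_add, div_le_iff₀ hq]; linarith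
  have e : (2 * (i : ℝ) + 1) / 2 ^ (p + 2) =
      ((i : ℝ) / 2 ^ (p + 1) + ((i : ℝ) + 1) / 2 ^ (p + 1)) / 2 := by
    rw [pow_succ _ (p + 1)]; field_simp; ring
  have hC : |(2 * (i : ℝ) + 1) / 2 ^ (p + 2) - m| ≤ 1 / 2 := by
    rw [e]
    rw [abs_le] at *
    constructor <;> linarith
  rw [tri_eq_of_abs_sub_le hA, tri_eq_of_abs_sub_le hB, tri_eq_of_abs_sub_le hC, e]
  ring

/-- The lacunary series of triangle waves with slopes `a k`. -/
noncomputable def wave (a : ℕ → ℝ) (x : ℝ) : ℝ := ∑' k, a k / 2 ^ k * tri (2 ^ k * x)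

section
variable {a : ℕ → ℝ}

lemma norm_wave_term_le (ha : Antitone a) (h0 : ∀ k, 0 ≤ a k) (n k : ℕ) (x : ℝ) :
    ‖a (k + n) / 2 ^ (k + n) * tri (2 ^ (k + n) * x)‖ ≤ a n / 2 ^ n / 2 / 2 ^ k := by
  rw [Real.norm_eq_abs, abs_mul, abs_of_nonneg (div_nonneg (h0 _) (by positivity))]
  calc a (k + n) / 2 ^ (k + n) * |tri (2 ^ (k + n) * x)|
      ≤ a n / 2 ^ (k + n) * (1 / 2) := by
        refine mul_le_mul ?_ (abs_tri_le _) (abs_nonneg _) (div_nonneg (h0 n) (by positivity))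
        gcongr
        exact ha (by omega)
    _ = _ := by rw [pow_add]; field_simp

lemma summable_wave_term (ha : Antitone a) (h0 : ∀ k, 0 ≤ a k) (x : ℝ) :
    Summable fun k => a k / 2 ^ k * tri (2 ^ k * x) :=
  Summable.of_norm_bounded (summable_geometric_two' _)
    fun k => by simpa using norm_wave_term_le ha h0 0 k x

lemma continuous_wave (ha : Antitone a) (h0 : ∀ k, 0 ≤ a k) : Continuous (wave a) :=
  continuous_tsum (fun k => continuous_const.mul (continuous_tri.comp (by fun_prop)))
    (summable_geometric_two' _)
    fun k x => by simpa using norm_wave_term_le ha h0 0 k x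

lemma abs_wave_tail_le (ha : Antitone a) (h0 : ∀ k, 0 ≤ a k) (n : ℕ) (x : ℝ) :
    |∑' k, a (k + n) / 2 ^ (k + n) * tri (2 ^ (k + n) * x)| ≤ a n / 2 ^ n := by
  have := tsum_of_norm_bounded (hasSum_geometric_two' (a n / 2 ^ n))
    (fun k => norm_wave_term_le ha h0 n k x)
  simpa using this

lemma abs_wave_le (ha : Antitone a) (h0 : ∀ k, 0 ≤ a k) (x : ℝ) : |wave a x| ≤ a 0 := by
  simpa [wave] using abs_wave_tail_le ha h0 0 x

/-- Slope at `x` of the `n`-th partial sum of `wave a`. -/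
noncomputable def waveSlope (a : ℕ → ℝ) (n : ℕ) (x : ℝ) : ℝ :=
  ∑ k ∈ Finset.range n, a k * (-1 : ℝ) ^ round (2 ^ k * x)

lemma wave_deviation (ha : Antitone a) (h0 : ∀ k, 0 ≤ a k) {b : ℝ} (hb : 0 ≤ b) {n : ℕ} {x y : ℝ}
    (hxy : n = 0 ∨ |y - x| < (2 ^ n)⁻¹)
    (hr : ∀ k < n, round (2 ^ k * x) = round (2 ^ k * y) ∨ a k ≤ b) :
    |wave a y - wave a x - waveSlope a n x * (y - x)| ≤ 2 * b * |y - x| + 2 * (a n / 2 ^ n) := by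
  have hs := fun x => (summable_wave_term ha h0 x).sum_add_tsum_nat_add n
  set t : ℕ → ℝ := fun k => a k / 2 ^ k * tri (2 ^ k * y) - a k / 2 ^ k * tri (2 ^ k * x)
    - a k * (-1 : ℝ) ^ round (2 ^ k * x) * (y - x) with ht
  have hzero : ∀ k, round (2 ^ k * x) = round (2 ^ k * y) → t k = 0 := by
    intro k hk
    simp only [ht, tri, ← hk]
    field_simp
    ring
  have hone : ∀ k, a k ≤ b → |t k| ≤ 2 * b * |y - x| := by
    intro k hk
    have hp : (0 : ℝ) < 2 ^ k := by positivity
    have e : t k = a k / 2 ^ k * (tri (2 ^ k * y) - tri (2 ^ k * x))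
        + - (a k * (-1 : ℝ) ^ round (2 ^ k * x) * (y - x)) := by simp only [ht]; ring
    have h1 : |tri (2 ^ k * y) - tri (2 ^ k * x)| ≤ 2 ^ k * |y - x| := by
      refine (abs_tri_sub_le _ _).trans_eq ?_
      rw [← mul_sub, abs_mul, abs_of_pos hp]
    rw [e]
    refine (abs_add_le _ _).trans ?_
    rw [abs_neg, abs_mul, abs_mul, abs_mul, abs_neg_one_zpow_int, abs_of_nonneg (h0 k),
      abs_of_nonneg (div_nonneg (h0 k) hp.le)]
    calc a k / 2 ^ k * |tri (2 ^ k * y) - tri (2 ^ k * x)| + a k * 1 * |y - x|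
        ≤ a k / 2 ^ k * (2 ^ k * |y - x|) + a k * 1 * |y - x| := by
          gcongr
          exact div_nonneg (h0 k) hp.le
      _ = 2 * a k * |y - x| := by field_simp; ring
      _ ≤ _ := by gcongr
  have hfin : |∑ k ∈ Finset.range n, t k| ≤ 2 * b * |y - x| := by
    by_cases hex : ∃ k < n, round (2 ^ k * x) ≠ round (2 ^ k * y)
    · obtain ⟨k, hkn, hk⟩ := hex
      rw [Finset.sum_eq_single k]
      · exact hone k ((hr k hkn).resolve_left hk)
      · intro l hl hlk
        by_contra hne
        have hl' : round (2 ^ l * x) ≠ round (2 ^ l * y) := fun h => hne (hzero l h)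
        have hln := Finset.mem_range.1 hl
        have hlt : |y - x| < ((2 : ℝ) ^ n)⁻¹ := hxy.resolve_left (by omega)
        have mono : ∀ j : ℕ, j < n → ((2 : ℝ) ^ n)⁻¹ ≤ (2 ^ (j + 1))⁻¹ := fun j hj =>
          inv_anti₀ (by positivity) (pow_le_pow_right₀ (by norm_num) hj)
        rcases lt_or_gt_of_ne hlk with h | h
        · linarith [inv_two_pow_le_of_round_ne h hl' hk, mono k hkn]
        · linarith [inv_two_pow_le_of_round_ne h hk hl', mono l hln]
      · intro h; exact absurd (Finset.mem_range.2 hkn) h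
    · push Not at hex
      rw [Finset.sum_eq_zero fun k hk => hzero k (hex k (Finset.mem_range.1 hk))]
      simpa using mul_nonneg (mul_nonneg zero_le_two hb) (abs_nonneg (y - x))
  have e : wave a y - wave a x - waveSlope a n x * (y - x) = ∑ k ∈ Finset.range n, t k
      + (∑' k, a (k + n) / 2 ^ (k + n) * tri (2 ^ (k + n) * y)
        - ∑' k, a (k + n) / 2 ^ (k + n) * tri (2 ^ (k + n) * x)) := by
    rw [wave, wave, ← hs x, ← hs y, waveSlope, Finset.sum_mul]
    simp only [ht, Finset.sum_sub_distrib]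
    ring
  rw [e]
  have h1 := abs_wave_tail_le ha h0 n y
  have h2 := abs_wave_tail_le ha h0 n x
  rw [abs_le] at *
  constructor <;> linarith

lemma wave_dyadic (n : ℕ) (i : ℤ) :
    wave a (i / 2 ^ n) = ∑ k ∈ Finset.range n, a k / 2 ^ k * tri (2 ^ k * (i / 2 ^ n)) := by
  refine tsum_eq_sum fun k hk => ?_
  obtain ⟨d, rfl⟩ := Nat.exists_eq_add_of_le (not_lt.1 fun h => hk (Finset.mem_range.2 h))
  have : (2 : ℝ) ^ (n + d) * (i / 2 ^ n) = ((2 ^ d * i : ℤ) : ℝ) := by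
    push_cast; rw [pow_add]; field_simp
  rw [this, tri_intCast, mul_zero]

lemma wave_midpoint (n : ℕ) (i : ℤ) : ∃ e : ℝ, (e = 1 ∨ e = -1) ∧
    wave a ((2 * i + 1) / 2 ^ (n + 1)) =
      (wave a (i / 2 ^ n) + wave a ((i + 1) / 2 ^ n)) / 2 + e * (a n / 2 ^ n / 2) := by
  refine ⟨(-1 : ℝ) ^ i, ?_, ?_⟩
  · rcases Int.even_or_odd i with h | h
    · exact Or.inl h.neg_one_zpow
    · exact Or.inr h.neg_one_zpow
  have h1 := wave_dyadic (a := a) (n + 1) (2 * i + 1)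
  have h3 := wave_dyadic (a := a) n i
  have h4 := wave_dyadic (a := a) n (i + 1)
  push_cast at h1 h3 h4
  rw [h1, h3, h4, Finset.sum_range_succ]
  congr 1
  · rw [← Finset.sum_add_distrib, Finset.sum_div]
    refine Finset.sum_congr rfl fun k hk => ?_
    obtain ⟨d, rfl⟩ := Nat.exists_eq_add_of_lt (Finset.mem_range.1 hk)
    have := tri_midpoint d i
    have e1 : (2 : ℝ) ^ k * ((2 * i + 1) / 2 ^ (k + d + 1 + 1)) = (2 * i + 1) / 2 ^ (d + 2) := by
      rw [show k + d + 1 + 1 = k + (d + 2) by ring, pow_add]; field_simp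
    have e2 : ∀ z : ℝ, (2 : ℝ) ^ k * (z / 2 ^ (k + d + 1)) = z / 2 ^ (d + 1) := by
      intro z
      rw [show k + d + 1 = k + (d + 1) by ring, pow_add]; field_simp
    rw [e1, e2, e2, this]
    ring
  · have e1 : (2 : ℝ) ^ n * ((2 * i + 1) / 2 ^ (n + 1)) = i + 1 / 2 := by
      rw [pow_succ]; field_simp
    rw [e1, tri_eq_of_abs_sub_le (m := i) (by rw [add_sub_cancel_left]; norm_num)]
    ring

end

section
variable {a : ℕ → ℝ}

/-- Slope of `wave a` between consecutive dyadic points of level `n`. -/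
noncomputable def dyadicSlope (a : ℕ → ℝ) (n : ℕ) (i : ℤ) : ℝ :=
  2 ^ n * (wave a ((i + 1) / 2 ^ n) - wave a (i / 2 ^ n))

lemma dyadicSlope_succ (n : ℕ) (i : ℤ) : ∃ e : ℝ, (e = 1 ∨ e = -1) ∧
    dyadicSlope a (n + 1) (2 * i) = dyadicSlope a n i + e * a n ∧
    dyadicSlope a (n + 1) (2 * i + 1) = dyadicSlope a n i - e * a n := by
  obtain ⟨e, he, h⟩ := wave_midpoint (a := a) n i
  refine ⟨e, he, ?_, ?_⟩
  · have e1 : ((2 * i : ℤ) : ℝ) / 2 ^ (n + 1) = i / 2 ^ n := by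
      push_cast; rw [pow_succ]; field_simp
    rw [dyadicSlope, dyadicSlope, e1]
    push_cast
    rw [h, pow_succ]
    field_simp
    ring
  · have e1 : (((2 * i + 1 : ℤ) : ℝ) + 1) / 2 ^ (n + 1) = (i + 1) / 2 ^ n := by
      push_cast; rw [pow_succ]; field_simp; ring
    rw [dyadicSlope, dyadicSlope, e1]
    push_cast
    rw [h, pow_succ]
    field_simp
    ring

lemma sum_range_two_mul (N : ℕ) (h : ℕ → ℝ) :
    ∑ r ∈ Finset.range (2 * N), h r = ∑ r ∈ Finset.range N, (h (2 * r) + h (2 * r + 1)) := by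
  induction N with
  | zero => simp
  | succ N ih =>
    rw [mul_add, mul_one, Finset.sum_range_succ, Finset.sum_range_succ, ih, Finset.sum_range_succ]
    ring

lemma sum_dyadicSlope_succ (g : ℝ → ℝ) (m p : ℕ) (j : ℤ) :
    ∑ r ∈ Finset.range (2 ^ (p + 1)), g (dyadicSlope a (m + (p + 1)) (j * 2 ^ (p + 1) + r)) =
      ∑ r ∈ Finset.range (2 ^ p), (g (dyadicSlope a (m + p) (j * 2 ^ p + r) + a (m + p))
        + g (dyadicSlope a (m + p) (j * 2 ^ p + r) - a (m + p))) := by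
  rw [pow_succ', sum_range_two_mul]
  refine Finset.sum_congr rfl fun r _ => ?_
  obtain ⟨e, he, h1, h2⟩ := dyadicSlope_succ (a := a) (m + p) (j * 2 ^ p + r)
  have e1 : j * (2 * 2 ^ p) + ((2 * r : ℕ) : ℤ) = 2 * (j * 2 ^ p + r) := by push_cast; ring
  have e2 : j * (2 * 2 ^ p) + ((2 * r + 1 : ℕ) : ℤ) = 2 * (j * 2 ^ p + r) + 1 := by
    push_cast; ring
  rw [pow_succ', e1, e2, ← add_assoc m, h1, h2]
  rcases he with rfl | rfl
  · simp
  · rw [add_comm]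
    congr 2 <;> ring

/-- Mean square of the level `m + p` slopes over a dyadic interval of level `m`. -/
noncomputable def slopeMeanSq (a : ℕ → ℝ) (m : ℕ) (j : ℤ) (p : ℕ) : ℝ :=
  dyadicSlope a m j ^ 2 + ∑ k ∈ Finset.range p, a (m + k) ^ 2

lemma sum_dyadicSlope_sq (m p : ℕ) (j : ℤ) :
    ∑ r ∈ Finset.range (2 ^ p), dyadicSlope a (m + p) (j * 2 ^ p + r) ^ 2 =
      2 ^ p * slopeMeanSq a m j p := by
  induction p with
  | zero => simp [slopeMeanSq]
  | succ p ih =>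
    rw [sum_dyadicSlope_succ (fun s => s ^ 2)]
    have : ∀ s c : ℝ, (s + c) ^ 2 + (s - c) ^ 2 = 2 * s ^ 2 + 2 * c ^ 2 := fun s c => by ring
    simp only [this]
    rw [Finset.sum_add_distrib, ← Finset.mul_sum, ih, slopeMeanSq, slopeMeanSq,
      Finset.sum_range_succ, Finset.sum_const, Finset.card_range, nsmul_eq_mul]
    push_cast
    ring

lemma slopeMeanSq_nonneg (m p : ℕ) (j : ℤ) : 0 ≤ slopeMeanSq a m j p :=
  add_nonneg (sq_nonneg _) (Finset.sum_nonneg fun _ _ => sq_nonneg _)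

lemma sum_dyadicSlope_pow_four_le (m p : ℕ) (j : ℤ) :
    ∑ r ∈ Finset.range (2 ^ p), dyadicSlope a (m + p) (j * 2 ^ p + r) ^ 4 ≤
      2 ^ p * (3 * slopeMeanSq a m j p ^ 2) := by
  induction p with
  | zero =>
    simp only [slopeMeanSq, pow_zero, Finset.range_one, Finset.sum_singleton, Finset.range_zero,
      Finset.sum_empty, add_zero, mul_one, one_mul, Nat.cast_zero]
    nlinarith [sq_nonneg (dyadicSlope a m j ^ 2)]
  | succ p ih =>
    rw [sum_dyadicSlope_succ (fun s => s ^ 4)]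
    have : ∀ s c : ℝ, (s + c) ^ 4 + (s - c) ^ 4 = 2 * s ^ 4 + 12 * c ^ 2 * s ^ 2 + 2 * c ^ 4 :=
      fun s c => by ring
    simp only [this]
    rw [Finset.sum_add_distrib, Finset.sum_add_distrib, ← Finset.mul_sum, ← Finset.mul_sum,
      sum_dyadicSlope_sq, Finset.sum_const, Finset.card_range, nsmul_eq_mul]
    have e : slopeMeanSq a m j (p + 1) = slopeMeanSq a m j p + a (m + p) ^ 2 := by
      rw [slopeMeanSq, slopeMeanSq, Finset.sum_range_succ]; ring
    rw [e]
    push_cast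
    have : 0 ≤ (2 : ℝ) ^ p * (a (m + p) ^ 2) ^ 2 := by positivity
    rw [pow_succ (2 : ℝ) p]
    nlinarith

lemma le_abs_of_moments {t : ℝ} (ht : 0 < t) (s : ℝ) :
    s ^ 2 / t - s ^ 4 / (4 * t ^ 3) ≤ |s| := by
  have h : s ^ 2 / t - s ^ 4 / (4 * t ^ 3) = (4 * t ^ 2 * |s| ^ 2 - |s| ^ 4) / (4 * t ^ 3) := by
    have : |s| ^ 4 = s ^ 4 := Even.pow_abs ⟨2, rfl⟩ s
    rw [sq_abs, this]
    field_simp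
  rw [h, div_le_iff₀ (by positivity)]
  have hs := abs_nonneg s
  set w := |s|
  have h1 : 0 ≤ (w - 6 / 5 * t) ^ 2 * (w + 12 / 5 * t) := by positivity
  have h2 : 0 ≤ t ^ 2 * w := by positivity
  have h3 : 0 ≤ t ^ 3 := by positivity
  have h4 : 0 ≤ w ^ 3 - 4 * t ^ 2 * w + 4 * t ^ 3 := by linarith
  nlinarith [mul_nonneg hs h4]

lemma le_sum_abs_dyadicSlope (m p : ℕ) (j : ℤ) :
    2 ^ p * (√(slopeMeanSq a m j p) / 4) ≤
      ∑ r ∈ Finset.range (2 ^ p), |dyadicSlope a (m + p) (j * 2 ^ p + r)| := by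
  set v := slopeMeanSq a m j p with hv
  rcases (slopeMeanSq_nonneg (a := a) m p j).eq_or_lt with h0 | hpos
  · rw [hv, ← h0]
    simp only [Real.sqrt_zero, zero_div, mul_zero]
    exact Finset.sum_nonneg fun _ _ => abs_nonneg _
  have hw : 0 < √v := Real.sqrt_pos.2 hpos
  set w := √v
  have hvw : v = w ^ 2 := (Real.sq_sqrt hpos.le).symm
  refine le_trans ?_ (Finset.sum_le_sum fun r _ =>
    le_abs_of_moments (t := 2 * w) (by positivity) (dyadicSlope a (m + p) (j * 2 ^ p + r)))
  rw [Finset.sum_sub_distrib, ← Finset.sum_div, ← Finset.sum_div, sum_dyadicSlope_sq, ← hv]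
  have h4 := sum_dyadicSlope_pow_four_le (a := a) m p j
  rw [← hv] at h4
  have : (∑ r ∈ Finset.range (2 ^ p), dyadicSlope a (m + p) (j * 2 ^ p + r) ^ 4)
      / (4 * (2 * w) ^ 3) ≤ 2 ^ p * (3 * v ^ 2) / (4 * (2 * w) ^ 3) := by gcongr
  refine le_trans ?_ (sub_le_sub_left this _)
  rw [hvw]
  have e : 2 ^ p * w ^ 2 / (2 * w) - 2 ^ p * (3 * (w ^ 2) ^ 2) / (4 * (2 * w) ^ 3)
      = 2 ^ p * (13 / 32 * w) := by
    field_simp; ring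
  rw [e]
  gcongr
  linarith

lemma exists_le_sum_abs_wave_sub (hdiv : ¬ Summable fun k => a k ^ 2) (m : ℕ) (j : ℤ) (M : ℝ) :
    ∃ p : ℕ, M ≤ ∑ r ∈ Finset.range (2 ^ p),
      |wave a ((j * 2 ^ p + (r + 1 : ℕ)) / 2 ^ (m + p)) - wave a ((j * 2 ^ p + r) / 2 ^ (m + p))| := by
  have hdiv' : ¬ Summable fun k => a (m + k) ^ 2 := by
    simpa only [add_comm m] using (summable_nat_add_iff m (f := fun k => a k ^ 2)).not.2 hdiv
  have ht := (not_summable_iff_tendsto_nat_atTop_of_nonneg (fun _ => sq_nonneg _)).1 hdiv'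
  obtain ⟨p, hp⟩ := (ht.eventually_ge_atTop ((4 * 2 ^ m * M) ^ 2)).exists
  refine ⟨p, ?_⟩
  have h1 : 4 * 2 ^ m * M ≤ √(slopeMeanSq a m j p) := by
    refine Real.le_sqrt_of_sq_le (hp.trans ?_)
    exact le_add_of_nonneg_left (sq_nonneg _)
  have h2 := le_sum_abs_dyadicSlope (a := a) m p j
  have e : ∀ r : ℕ, |wave a ((j * 2 ^ p + (r + 1 : ℕ)) / 2 ^ (m + p))
      - wave a ((j * 2 ^ p + r) / 2 ^ (m + p))|
      = |dyadicSlope a (m + p) (j * 2 ^ p + r)| / 2 ^ (m + p) := by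
    intro r
    rw [dyadicSlope, abs_mul, abs_of_pos (by positivity : (0 : ℝ) < 2 ^ (m + p))]
    push_cast
    rw [← add_assoc]
    field_simp
  simp only [e]
  rw [← Finset.sum_div, le_div_iff₀ (by positivity)]
  refine le_trans ?_ h2
  rw [pow_add]
  have : (0 : ℝ) < 2 ^ p := by positivity
  nlinarith

end

section
/-- The parametrisation `x ↦ (x, f x)` of the graph of `f`. -/
noncomputable def graphMap (f : ℝ → ℝ) (x : ℝ) : EuclideanSpace ℝ (Fin 2) := !₂[x, f x]

lemma continuous_graphMap {f : ℝ → ℝ} (hf : Continuous f) : Continuous (graphMap f) := by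
  unfold graphMap
  fun_prop

lemma abs_apply_sub_le_dist (p q : EuclideanSpace ℝ (Fin 2)) (i : Fin 2) : |p i - q i| ≤ dist p q := by
  simpa [dist_eq_norm] using PiLp.norm_apply_le (p - q) i

lemma abs_sub_le_hausdorffMeasure_graph {f : ℝ → ℝ} (hf : Continuous f) {x y : ℝ} (hxy : x ≤ y) :
    ENNReal.ofReal |f y - f x| ≤ μH[1] (graphMap f '' Ico x y) := by
  have h1 : (fun p : EuclideanSpace ℝ (Fin 2) => p 1) '' (graphMap f '' Ico x y) = f '' Ico x y := by
    rw [image_image]; simp [graphMap]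
  have hL : LipschitzWith 1 (fun p : EuclideanSpace ℝ (Fin 2) => p 1) :=
    LipschitzWith.of_dist_le_mul fun p q => by
      simpa [Real.dist_eq] using abs_apply_sub_le_dist p q 1
  have h2 := hL.hausdorffMeasure_image_le zero_le_one (graphMap f '' Ico x y)
  rw [h1, hausdorffMeasure_real] at h2
  simp only [ENNReal.coe_one, ENNReal.one_rpow, one_mul] at h2
  refine le_trans ?_ h2
  have h3 : uIcc (f x) (f y) ⊆ f '' Ico x y ∪ {f y} := by
    refine (intermediate_value_uIcc hf.continuousOn).trans ?_
    rw [uIcc_of_le hxy, ← Ico_insert_right hxy, image_insert_eq]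
    intro z hz
    rcases hz with h | h
    · exact Or.inr h
    · exact Or.inl h
  calc ENNReal.ofReal |f y - f x| = volume (uIcc (f x) (f y)) := by
        rw [Real.volume_interval]
    _ ≤ volume (f '' Ico x y ∪ {f y}) := measure_mono h3
    _ ≤ volume (f '' Ico x y) + volume {f y} := measure_union_le _ _
    _ = _ := by simp

lemma sum_abs_sub_le_hausdorffMeasure_graph {f : ℝ → ℝ} (hf : Continuous f) {x : ℕ → ℝ}
    (hx : Monotone x) (N : ℕ) :
    ENNReal.ofReal (∑ r ∈ Finset.range N, |f (x (r + 1)) - f (x r)|) ≤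
      μH[1] (graphMap f '' Ico (x 0) (x N)) := by
  induction N with
  | zero => simp
  | succ N ih =>
    rw [Finset.sum_range_succ,
      ENNReal.ofReal_add (Finset.sum_nonneg fun _ _ => abs_nonneg _) (abs_nonneg _)]
    refine (add_le_add ih (abs_sub_le_hausdorffMeasure_graph hf (hx (Nat.le_succ N)))).trans ?_
    have hm : MeasurableSet {p : EuclideanSpace ℝ (Fin 2) | p 0 < x N} :=
      measurableSet_lt (by fun_prop) measurable_const
    have hdis : graphMap f '' Ico (x 0) (x (N + 1)) ∩ {p : EuclideanSpace ℝ (Fin 2) | p 0 < x N} ⊇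
        graphMap f '' Ico (x 0) (x N) := by
      rintro _ ⟨z, hz, rfl⟩
      exact ⟨⟨z, ⟨hz.1, hz.2.trans_le (hx (Nat.le_succ N))⟩, rfl⟩, by simpa [graphMap] using hz.2⟩
    have hdis' : graphMap f '' Ico (x 0) (x (N + 1)) \ {p : EuclideanSpace ℝ (Fin 2) | p 0 < x N} ⊇
        graphMap f '' Ico (x N) (x (N + 1)) := by
      rintro _ ⟨z, hz, rfl⟩
      exact ⟨⟨z, ⟨(hx (Nat.zero_le N)).trans hz.1, hz.2⟩, rfl⟩, by simpa [graphMap] using hz.1⟩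
    rw [← measure_inter_add_sdiff (μ := μH[1]) (graphMap f '' Ico (x 0) (x (N + 1))) hm]
    exact add_le_add (measure_mono hdis) (measure_mono hdis')

lemma exists_dense_Gδ_hausdorffMeasure_graph_eq_zero {f : ℝ → ℝ} (hf : Continuous f) :
    ∃ U : Set ℝ, IsGδ U ∧ Dense U ∧ μH[1] (graphMap f '' U) = 0 := by
  have hb : ∀ k : ℕ, ((k : ℝ≥0∞) + 1)⁻¹ ≠ 0 := fun k => by simp
  choose ε hε hsum using fun k => ENNReal.exists_pos_sum_of_countable (hb k) ℕ
  have hq : ∀ k i : ℕ, ∃ V : Set ℝ, IsOpen V ∧ TopologicalSpace.denseSeq ℝ i ∈ V ∧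
      ediam (graphMap f '' V) ≤ ε k i := by
    intro k i
    have h1 : Metric.eball (graphMap f (TopologicalSpace.denseSeq ℝ i)) (ε k i / 2)
        ∈ nhds (graphMap f (TopologicalSpace.denseSeq ℝ i)) :=
      Metric.eball_mem_nhds _ (ENNReal.div_pos (by exact_mod_cast (hε k i).ne') (by simp))
    obtain ⟨V, hV, hVo, hVm⟩ := _root_.mem_nhds_iff.1 ((continuous_graphMap hf).continuousAt h1)
    refine ⟨V, hVo, hVm, (Metric.ediam_mono (image_subset_iff.2 hV)).trans ?_⟩
    refine Metric.ediam_eball_le.trans ?_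
    rw [ENNReal.mul_div_cancel (by simp) (by simp)]
  choose V hVo hVm hVd using hq
  refine ⟨⋂ k, ⋃ i, V k i, IsGδ.iInter_of_isOpen fun k => isOpen_iUnion (hVo k), ?_, ?_⟩
  · refine dense_iInter_of_isOpen (fun k => isOpen_iUnion (hVo k)) fun k => ?_
    refine (TopologicalSpace.denseRange_denseSeq ℝ).mono ?_
    rintro _ ⟨i, rfl⟩
    exact mem_iUnion.2 ⟨i, hVm k i⟩
  · have hlim : Filter.Tendsto (fun k : ℕ => ((k : ℝ≥0∞) + 1)⁻¹) Filter.atTop (nhds 0) := by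
      have := (Filter.tendsto_add_atTop_iff_nat 1).2 ENNReal.tendsto_inv_nat_nhds_zero
      simpa using this
    have hs : ∀ k, ∑' i, ediam (graphMap f '' V k i) ≤ ((k : ℝ≥0∞) + 1)⁻¹ := fun k =>
      (ENNReal.tsum_le_tsum (hVd k)).trans (hsum k).le
    have := Measure.hausdorffMeasure_le_liminf_tsum 1 (graphMap f '' ⋂ k, ⋃ i, V k i) _ hlim
      (fun k i => graphMap f '' V k i)
      (.of_forall fun k i => (ENNReal.le_tsum i).trans (hs k))
      (.of_forall fun k => by
        rw [← image_iUnion]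
        exact image_mono (iInter_subset _ k))
    simp only [ENNReal.rpow_one] at this
    refine le_antisymm (this.trans ?_) zero_le
    rw [← hlim.liminf_eq]
    exact Filter.liminf_le_liminf (.of_forall hs)

end

section
variable {a : ℕ → ℝ}

lemma hausdorffMeasure_graph_wave_eq_top (ha : Antitone a) (h0 : ∀ k, 0 ≤ a k)
    (hdiv : ¬ Summable fun k => a k ^ 2) {U : Set ℝ} (hU : (interior U).Nonempty) :
    μH[1] (graphMap (wave a) '' U) = ⊤ := by
  obtain ⟨z, hz⟩ := hU
  obtain ⟨ε, hε, hball⟩ := Metric.isOpen_iff.1 isOpen_interior z hz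
  obtain ⟨m, hm⟩ := exists_pow_lt_of_lt_one hε (by norm_num : (1 / 2 : ℝ) < 1)
  have hm' : 1 < ε * 2 ^ m := by
    rwa [one_div, inv_pow, inv_lt_iff_one_lt_mul₀ (by positivity)] at hm
  set j : ℤ := ⌊z * 2 ^ m⌋
  have hj1 : (j : ℝ) ≤ z * 2 ^ m := Int.floor_le _
  have hj2 : z * 2 ^ m < j + 1 := Int.lt_floor_add_one _
  have hp : (0 : ℝ) < 2 ^ m := by positivity
  have hI : Ico ((j : ℝ) / 2 ^ m) ((j + 1) / 2 ^ m) ⊆ U := by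
    intro y hy
    refine interior_subset (hball ?_)
    rw [mem_Ico, div_le_iff₀ hp, lt_div_iff₀ hp] at hy
    rw [Metric.mem_ball, Real.dist_eq, abs_lt]
    constructor <;> nlinarith
  refine ENNReal.eq_top_of_forall_nnreal_le fun M => ?_
  obtain ⟨p, hM⟩ := exists_le_sum_abs_wave_sub hdiv m j M
  have h1 := sum_abs_sub_le_hausdorffMeasure_graph (continuous_wave ha h0)
    (x := fun r => (j * 2 ^ p + r) / 2 ^ (m + p))
    (fun r s hrs => by dsimp only; gcongr) (2 ^ p)
  have e0 : ((j : ℝ) * 2 ^ p + (0 : ℕ)) / 2 ^ (m + p) = j / 2 ^ m := by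
    rw [pow_add]; field_simp; simp
  have e1 : ((j : ℝ) * 2 ^ p + (2 ^ p : ℕ)) / 2 ^ (m + p) = (j + 1) / 2 ^ m := by
    rw [pow_add]; push_cast; field_simp
  rw [e0, e1] at h1
  calc (M : ℝ≥0∞) = ENNReal.ofReal M := by simp
    _ ≤ _ := ENNReal.ofReal_le_ofReal hM
    _ ≤ _ := h1
    _ ≤ _ := measure_mono (image_mono hI)

end

lemma hausdorffMeasure_closure_le_packPre (F : Set (EuclideanSpace ℝ (Fin 2))) {η : ℝ}
    (hη : 0 < η) : μH[1] (closure F) ≤ 5 * packPre 1 η F := by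
  set r : ℕ → ℝ := fun n => min η (1 / (n + 1)) with hr
  have hr0 : ∀ n, 0 < r n := fun n => lt_min hη (by positivity)
  have hrη : ∀ n, r n ≤ η := fun n => min_le_left _ _
  have hv : ∀ n, ∃ u ⊆ F, (u.PairwiseDisjoint fun c => closedBall c (r n)) ∧
      ∀ c ∈ F, ∃ b ∈ u, closedBall c (r n) ⊆ closedBall b (5 * r n) := fun n =>
    Vitali.exists_disjoint_subfamily_covering_enlargement_closedBall F id (fun _ => r n) (r n)
      (fun _ _ => le_rfl) 5 (by norm_num)
  choose u huF hud huc using hv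
  have hcount : ∀ n, (u n).Countable := fun n =>
    (hud n).countable_of_nonempty_interior fun c _ =>
      ⟨c, ball_subset_interior_closedBall (mem_ball_self (hr0 n))⟩
  have : ∀ n, Countable (u n) := fun n => (hcount n).to_subtype
  have hpack : ∀ n, ∑' _ : u n, ENNReal.ofReal (2 * r n) ≤ packPre 1 η F := by
    intro n
    have hinj : InjOn (fun c : EuclideanSpace ℝ (Fin 2) => (c, r n)) (u n) :=
      fun c _ d _ h => (Prod.ext_iff.1 h).1
    refine le_trans (le_of_eq ?_) (le_iSup₂_of_le ((fun c => (c, r n)) '' u n) ?_ le_rfl)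
    · rw [tsum_image (fun p : EuclideanSpace ℝ (Fin 2) × ℝ =>
        ENNReal.ofReal (diam (closedBall p.1 p.2)) ^ 1) hinj]
      refine tsum_congr fun c => ?_
      rw [pow_one, diam_closedBall_eq _ (hr0 n).le]
    · refine ⟨(hcount n).image _, ?_, ?_⟩
      · rintro _ ⟨c, hc, rfl⟩
        exact ⟨huF n hc, hr0 n, hrη n⟩
      · rintro _ ⟨c, hc, rfl⟩ _ ⟨d, hd, rfl⟩ hne
        exact hud n hc hd fun h => hne (by rw [h])
  have hdiam : ∀ n (c : u n), ediam (closedBall (c : EuclideanSpace ℝ (Fin 2)) (5 * r n)) ≤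
      5 * ENNReal.ofReal (2 * r n) := by
    intro n c
    rw [← Metric.closedEBall_ofReal (by have := hr0 n; positivity)]
    refine Metric.ediam_closedEBall_le.trans (le_of_eq ?_)
    rw [ENNReal.ofReal_mul (by norm_num), ENNReal.ofReal_mul (by norm_num)]
    simp only [ENNReal.ofReal_ofNat]
    ring
  have hlim : Filter.Tendsto (fun n => 5 * ENNReal.ofReal (2 * r n)) Filter.atTop (nhds 0) := by
    have h1 : Filter.Tendsto r Filter.atTop (nhds 0) :=
      squeeze_zero (fun n => (hr0 n).le) (fun n => min_le_right _ _)
        tendsto_one_div_add_atTop_nhds_zero_nat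
    have h2 := ENNReal.Tendsto.const_mul (a := 5) (ENNReal.tendsto_ofReal (h1.const_mul 2))
      (Or.inr (by simp))
    simpa using h2
  have hcov : ∀ n, closure F ⊆ ⋃ c : u n, closedBall (c : EuclideanSpace ℝ (Fin 2)) (5 * r n) := by
    intro n x hx
    obtain ⟨c, hc, hxc⟩ := Metric.mem_closure_iff.1 hx (r n) (hr0 n)
    obtain ⟨b, hb, hsub⟩ := huc n c hc
    exact mem_iUnion.2 ⟨⟨b, hb⟩, hsub (mem_closedBall.2 hxc.le)⟩
  refine (Measure.hausdorffMeasure_le_liminf_tsum 1 (closure F) _ hlim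
    (fun n (c : u n) => closedBall (c : EuclideanSpace ℝ (Fin 2)) (5 * r n))
    (.of_forall hdiam) (.of_forall hcov)).trans ?_
  simp only [ENNReal.rpow_one]
  refine Filter.liminf_le_of_le (by isBoundedDefault) fun b hb => ?_
  obtain ⟨n, hn⟩ := hb.exists
  refine hn.trans ((ENNReal.tsum_le_tsum (hdiam n)).trans ?_)
  rw [ENNReal.tsum_mul_left]
  gcongr
  exact hpack n

lemma packPre0_eq_top_of_hausdorffMeasure_closure {F : Set (EuclideanSpace ℝ (Fin 2))}
    (h : μH[1] (closure F) = ⊤) : packPre0 1 F = ⊤ := by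
  simp only [packPre0, iInf_eq_top]
  intro η hη
  have h1 := hausdorffMeasure_closure_le_packPre F hη
  rw [h, top_le_iff, ENNReal.mul_eq_top] at h1
  simpa using h1

lemma packMeasure_graph_wave_eq_top {a : ℕ → ℝ} (ha : Antitone a) (h0 : ∀ k, 0 ≤ a k)
    (hdiv : ¬ Summable fun k => a k ^ 2) {U J : Set ℝ} (hU : IsGδ U) (hUd : Dense U)
    (hJ : IsOpen J) (hJne : J.Nonempty) :
    packMeasure 1 (graphMap (wave a) '' (U ∩ J)) = ⊤ := by
  simp only [packMeasure, iInf_eq_top]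
  intro F hF
  suffices ∃ i, packPre0 1 (F i) = ⊤ by
    obtain ⟨i, hi⟩ := this
    exact ENNReal.tsum_eq_top_of_eq_top ⟨i, hi⟩
  set T : Option ℕ → Set ℝ := fun o =>
    o.elim Jᶜ fun i => closure (graphMap (wave a) ⁻¹' F i) with hT
  have hTc : ∀ o, IsClosed (T o) := by
    rintro (_ | i)
    · exact hJ.isClosed_compl
    · exact isClosed_closure
  have hcov : U ⊆ ⋃ o, T o := by
    intro x hx
    by_cases hxJ : x ∈ J
    · obtain ⟨i, hi⟩ := mem_iUnion.1 (hF ⟨x, ⟨hx, hxJ⟩, rfl⟩)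
      exact mem_iUnion.2 ⟨some i, subset_closure hi⟩
    · exact mem_iUnion.2 ⟨none, hxJ⟩
  obtain ⟨x, hxJ, hx⟩ := (hU.dense_iUnion_interior_of_closed hUd hTc hcov).inter_open_nonempty
    J hJ hJne
  obtain ⟨o, ho⟩ := mem_iUnion.1 hx
  rcases o with _ | i
  · exact absurd hxJ (interior_subset ho)
  refine ⟨i, packPre0_eq_top_of_hausdorffMeasure_closure ?_⟩
  refine top_unique ?_
  rw [← hausdorffMeasure_graph_wave_eq_top ha h0 hdiv ⟨x, ho⟩]
  refine measure_mono (image_subset_iff.2 ?_)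
  exact (continuous_graphMap (continuous_wave ha h0)).closure_preimage_subset _

lemma graphMap_mem_nbhd_affPlane {f : ℝ → ℝ} {x y s ε : ℝ}
    (h : |f y - f x - s * (y - x)| ≤ ε) :
    graphMap f y ∈ nbhd (affPlane (graphMap f x) (ℝ ∙ (!₂[1, s] : EuclideanSpace ℝ (Fin 2)))) ε := by
  set z : EuclideanSpace ℝ (Fin 2) := graphMap f x + (y - x) • !₂[1, s] with hz
  have hzm : z ∈ affPlane (graphMap f x) (ℝ ∙ (!₂[1, s] : EuclideanSpace ℝ (Fin 2))) := by
    simp only [affPlane, mem_ofPred_eq, hz, add_sub_cancel_left]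
    exact Submodule.smul_mem _ _ (Submodule.mem_span_singleton_self _)
  refine (infDist_le_dist_of_mem hzm).trans (le_trans (le_of_eq ?_) h)
  rw [EuclideanSpace.dist_eq, Fin.sum_univ_two]
  simp only [hz, graphMap, PiLp.add_apply, PiLp.smul_apply, Matrix.cons_val_zero,
    Matrix.cons_val_one, smul_eq_mul, Real.dist_eq, sq_abs]
  rw [← Real.sqrt_sq_eq_abs]
  congr 1
  ring

lemma exists_dyadic_scale {h : ℝ} (hh : 0 < h) :
    ∃ n : ℕ, (n = 0 ∨ h < ((2 : ℝ) ^ n)⁻¹) ∧ ((2 : ℝ) ^ n)⁻¹ ≤ 4 * h := by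
  rcases le_or_gt (1 / 2) h with h1 | h1
  · exact ⟨0, Or.inl rfl, by norm_num; linarith⟩
  · obtain ⟨n, hn1, hn2⟩ := exists_nat_pow_near (x := (2 * h)⁻¹) (y := (2 : ℝ))
      (by rw [one_le_inv₀ (by positivity)]; linarith) (by norm_num)
    have hp : (0 : ℝ) < 2 ^ n := by positivity
    rw [le_inv_comm₀ hp (by positivity)] at hn1
    rw [inv_lt_comm₀ (by positivity) (by positivity), pow_succ, mul_inv] at hn2
    exact ⟨n, Or.inr (by linarith), by linarith⟩

lemma exists_line_graph_wave {a : ℕ → ℝ} (ha : Antitone a) (h0 : ∀ k, 0 ≤ a k) {b : ℝ} (hb : 0 ≤ b)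
    {S : Set ℝ} {x h : ℝ} (hh : 0 < h) (hn : ∀ n : ℕ, ((2 : ℝ) ^ n)⁻¹ ≤ 4 * h → a n ≤ b)
    (hr : ∀ y, |y - x| ≤ h → ∀ k : ℕ, round (2 ^ k * x) = round (2 ^ k * y) ∨ a k ≤ b) :
    ∃ W : Submodule ℝ (EuclideanSpace ℝ (Fin 2)), Module.finrank ℝ W = 1 ∧
      closedBall (graphMap (wave a) x) h ∩ graphMap (wave a) '' S ⊆
        nbhd (affPlane (graphMap (wave a) x) W) (10 * b * h) := by
  obtain ⟨n, hn1, hn2⟩ := exists_dyadic_scale hh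
  refine ⟨ℝ ∙ !₂[1, waveSlope a n x], finrank_span_singleton fun h => ?_, ?_⟩
  · simpa using congrArg (fun p : EuclideanSpace ℝ (Fin 2) => p 0) h
  · rintro _ ⟨hy, y, -, rfl⟩
    have hyx : |y - x| ≤ h :=
      (abs_apply_sub_le_dist (graphMap (wave a) y) (graphMap (wave a) x) 0).trans hy
    refine graphMap_mem_nbhd_affPlane ((wave_deviation ha h0 hb
      (hn1.imp_right hyx.trans_lt) fun k _ => hr y hyx k).trans ?_)
    have h1 : 2 * b * |y - x| ≤ 2 * b * h := by gcongr
    have h2 : a n / 2 ^ n ≤ b * (4 * h) := by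
      rw [div_eq_mul_inv]
      exact mul_le_mul (hn n hn2) hn2 (by positivity) hb
    linarith

lemma eventually_round_eq {y : ℝ} (hy : ∀ i : ℤ, y ≠ i + 1 / 2) :
    ∀ᶠ x in nhds y, round x = round y := by
  obtain ⟨h1, h2⟩ := round_bounds y
  have h3 : (round y : ℝ) - 1 / 2 < y := by
    refine lt_of_le_of_ne (by linarith) fun h => hy (round y - 1) ?_
    push_cast
    linarith
  filter_upwards [Ioo_mem_nhds h3 h2] with x hx
  exact round_eq_iff.2 ⟨hx.1.le, hx.2⟩

lemma rwRho_graph_wave {a : ℕ → ℝ} (ha : Antitone a) (h0 : ∀ k, 0 ≤ a k)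
    (hlim : Filter.Tendsto a Filter.atTop (nhds 0)) {S : Set ℝ}
    (hS : ∀ y ∈ S, ∀ (k : ℕ) (i : ℤ), 2 ^ k * y ≠ i + 1 / 2) {γ : ℝ} (hγ : 0 < γ) :
    RwRho 1 γ (graphMap (wave a) '' S) := by
  rintro _ ⟨y, hy, rfl⟩
  obtain ⟨N, hN⟩ := (hlim.eventually_le_const (by positivity : 0 < γ / 10)).exists
  have hev : ∀ᶠ x in nhds y, ∀ k ∈ Finset.range N, round (2 ^ k * x) = round (2 ^ k * y) := by
    rw [Filter.eventually_all_finset]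
    intro k _
    exact ((continuous_const_mul ((2 : ℝ) ^ k)).tendsto y).eventually (eventually_round_eq (hS y hy k))
  obtain ⟨ε, hε, hball⟩ := Metric.eventually_nhds_iff.1 hev
  have hround : ∀ x, |x - y| < ε → ∀ k : ℕ, round (2 ^ k * x) = round (2 ^ k * y) ∨ a k ≤ γ / 10 := by
    intro x hx k
    rcases lt_or_ge k N with h | h
    · exact Or.inl (hball hx k (Finset.mem_range.2 h))
    · exact Or.inr ((ha h).trans hN)
  refine ⟨min (ε / 3) (((2 : ℝ) ^ N)⁻¹ / 8), by positivity, ?_⟩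
  rintro _ ⟨hx, x, -, rfl⟩ ρ ⟨hρ0, hρ⟩
  have hρ1 : ρ ≤ ε / 3 := hρ.trans (min_le_left _ _)
  have hρ2 : ρ ≤ ((2 : ℝ) ^ N)⁻¹ / 8 := hρ.trans (min_le_right _ _)
  have hxy : |x - y| ≤ ε / 3 :=
    (abs_apply_sub_le_dist (graphMap (wave a) x) (graphMap (wave a) y) 0).trans
      ((mem_closedBall.1 hx).trans (min_le_left _ _))
  have := exists_line_graph_wave (S := S) (x := x) ha h0 (by positivity : 0 ≤ γ / 10) hρ0
    (fun n hn => (ha ?_).trans hN) fun z hz k => ?_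
  · rwa [show 10 * (γ / 10) * ρ = γ * ρ by ring] at this
  · by_contra hlt
    have h1 : ((2 : ℝ) ^ N)⁻¹ ≤ (2 ^ n)⁻¹ :=
      inv_anti₀ (by positivity) (pow_le_pow_right₀ (by norm_num) (not_le.1 hlt).le)
    have h2 : (0 : ℝ) < (2 ^ N)⁻¹ := by positivity
    linarith
  · have hzy : |z - y| < ε := by
      have := abs_sub_le z x y
      linarith
    rcases hround x (by linarith) k with h | h
    · exact (hround z hzy k).imp_left fun h' => h.trans h'.symm
    · exact Or.inr h

lemma RwRho.rwEmpty {n j : ℕ} {γ : ℝ} {A : Set (EuclideanSpace ℝ (Fin n))} (h : RwRho j γ A) :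
    RwEmpty j γ A := by
  intro y hy
  obtain ⟨ρ, hρ, H⟩ := h y hy
  exact ⟨ρ, hρ, H y ⟨mem_closedBall_self hρ.le, hy⟩⟩

lemma rwRho0_graph_wave {a : ℕ → ℝ} (ha : Antitone a) (h0 : ∀ k, 0 ≤ a k) {δ : ℝ}
    (h1 : a 0 ≤ 1) (hδ : a 0 ≤ δ / 10) {S : Set ℝ} (hS : S ⊆ Ioo 0 1) :
    RwRho0 1 δ (graphMap (wave a) '' S) := by
  refine ⟨2, by norm_num, ⟨0, ?_⟩, ?_⟩
  · rintro _ ⟨x, hx, rfl⟩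
    have hx1 := hS hx
    have hw := (abs_wave_le ha h0 x).trans h1
    rw [mem_closedBall, dist_zero_right, EuclideanSpace.norm_eq, Fin.sum_univ_two]
    refine Real.sqrt_le_iff.2 ⟨by norm_num, ?_⟩
    simp only [graphMap, Matrix.cons_val_zero, Matrix.cons_val_one, Real.norm_eq_abs, sq_abs]
    have h2 : wave a x ^ 2 ≤ 1 := (sq_le_one_iff_abs_le_one _).2 hw
    nlinarith [hx1.1, hx1.2]
  · rintro _ ⟨x, -, rfl⟩ ρ ⟨hρ, -⟩
    have hle : ∀ k, a k ≤ δ / 10 := fun k => (ha (Nat.zero_le k)).trans hδ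
    have := exists_line_graph_wave (S := S) (x := x) ha h0 ((h0 0).trans hδ) hρ
      (fun n _ => hle n) fun z _ k => Or.inr (hle k)
    rwa [show 10 * (δ / 10) * ρ = δ * ρ by ring] at this

lemma not_summable_sq_div_sqrt {c : ℝ} (hc : c ≠ 0) :
    ¬ Summable fun k : ℕ => (c / √(k + 1)) ^ 2 := by
  intro h
  have e : ∀ k : ℕ, (c / √(k + 1)) ^ 2 = c ^ 2 * (1 / ((k + 1 : ℕ) : ℝ)) := by
    intro k
    rw [div_pow, Real.sq_sqrt (by positivity)]
    push_cast
    ring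
  simp only [e] at h
  rw [summable_mul_left_iff (pow_ne_zero 2 hc),
    summable_nat_add_iff 1 (f := fun k : ℕ => 1 / (k : ℝ))] at h
  exact Real.not_summable_one_div_natCast h

/-- for every `δ ∈ (0,1)` there is a set `A ⊆ ℝ²` satisfying the fine
weak `ρ_y`-uniform `1`-dimensional property (hence the fine weak property without
uniformity and every weak `γ`-approximation for `γ ∈ (0,1)`) and the `ρ0`-uniform
weak `δ`-approximation property, yet with `P¹(A) ≠ H¹(A)`. -/
theorem pack_ne_hausdorff_example (δ : ℝ) (hδ : δ ∈ Set.Ioo (0:ℝ) 1) :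
    ∃ A : Set (EuclideanSpace ℝ (Fin 2)),
      (∀ γ ∈ Set.Ioo (0:ℝ) 1, RwRho 1 γ A) ∧
      (∀ γ ∈ Set.Ioo (0:ℝ) 1, RwEmpty 1 γ A) ∧
      RwRho0 1 δ A ∧
      packMeasure 1 A ≠ μH[(1 : ℝ)] A := by
  obtain ⟨hδ0, hδ1⟩ := hδ
  set a : ℕ → ℝ := fun k => δ / 10 / √(k + 1) with haDef
  have h0 : ∀ k, 0 ≤ a k := fun k => by positivity
  have ha : Antitone a := fun k l hkl => by
    simp only [haDef]
    gcongr
  have ha0 : a 0 = δ / 10 := by simp [haDef]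
  have hlim : Filter.Tendsto a Filter.atTop (nhds 0) :=
    Filter.Tendsto.const_div_atTop (Real.tendsto_sqrt_atTop.comp
      (Filter.tendsto_atTop_add_const_right _ 1 tendsto_natCast_atTop_atTop)) _
  have hdiv : ¬ Summable fun k => a k ^ 2 := not_summable_sq_div_sqrt (by positivity)
  obtain ⟨U, hUG, hUd, hU0⟩ :=
    exists_dense_Gδ_hausdorffMeasure_graph_eq_zero (continuous_wave ha h0)
  set D : Set ℝ := range fun q : ℕ × ℤ => ((q.2 : ℝ) + 1 / 2) / 2 ^ q.1
  have hDc : D.Countable := countable_range _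
  have hDd : Dense Dᶜ := hDc.dense_compl ℝ
  have hS : ∀ y ∈ U ∩ Dᶜ ∩ Ioo 0 1, ∀ (k : ℕ) (i : ℤ), 2 ^ k * y ≠ i + 1 / 2 := by
    rintro y ⟨⟨-, hyD⟩, -⟩ k i h
    refine hyD ⟨(k, i), ?_⟩
    dsimp only
    rw [← h]
    field_simp
  have hrho : ∀ γ ∈ Ioo (0 : ℝ) 1, RwRho 1 γ (graphMap (wave a) '' (U ∩ Dᶜ ∩ Ioo 0 1)) :=
    fun γ hγ => rwRho_graph_wave ha h0 hlim hS hγ.1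
  refine ⟨graphMap (wave a) '' (U ∩ Dᶜ ∩ Ioo 0 1), hrho, fun γ hγ => (hrho γ hγ).rwEmpty,
    rwRho0_graph_wave ha h0 (by linarith) ha0.le inter_subset_right, ?_⟩
  rw [packMeasure_graph_wave_eq_top ha h0 hdiv (hUG.inter hDc.isGδ_compl)
    (hUd.inter_of_Gδ hUG hDc.isGδ_compl hDd) isOpen_Ioo (nonempty_Ioo.2 one_pos),
    measure_mono_null (image_mono (inter_subset_left.trans inter_subset_left)) hU0]
  exact ENNReal.top_ne_zero

end ReifenbergPaper
end
end

section
/- Let n ∈ ℕ, j ≤ n, and suppose A ⊆ ℝⁿ satisfies A ∈ R(w,ρ0,fine;j) or A ∈ R(s,β,γ;j) for some β ∈ {∅, ρ, ρ0} and γ ∈ Δ := {fine} ∪ (0,1). Then P^j(A) = H^j(A), i.e. the j-dimensional packing and Hausdorff measures of A coincide. -/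
open Metric Set MeasureTheory ENNReal NNReal

attribute [local instance] Classical.propDecidable

noncomputable section

namespace ReifenbergPaper

theorem volume_add_volume_le_of_dist_le {P Q : Set ℝ} (hP : P.Nonempty) (hQ : Q.Nonempty) {D : ℝ}
    (h : ∀ s ∈ P, ∀ t ∈ Q, |s - t| ≤ D) :
    volume P + volume Q ≤ ENNReal.ofReal (2 * D) := by
  obtain ⟨s₀, hs₀⟩ := hP
  obtain ⟨t₀, ht₀⟩ := hQ
  have hbelow : BddBelow Q := ⟨s₀ - D, fun t ht => by linarith [(abs_le.1 (h s₀ hs₀ t ht)).2]⟩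
  have habove : BddAbove Q := ⟨s₀ + D, fun t ht => by linarith [(abs_le.1 (h s₀ hs₀ t ht)).1]⟩
  have hQ' : Q ⊆ Set.Icc (sInf Q) (sSup Q) := fun t ht => ⟨csInf_le hbelow ht, le_csSup habove ht⟩
  have hle : sInf Q ≤ sSup Q := (hQ' ht₀).1.trans (hQ' ht₀).2
  have hP' : P ⊆ Set.Icc (sSup Q - D) (sInf Q + D) := by
    intro s hs
    constructor
    · have : sSup Q ≤ s + D := csSup_le ⟨t₀, ht₀⟩ fun t ht => by
        linarith [(abs_le.1 (h s hs t ht)).1]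
      linarith
    · have : s - D ≤ sInf Q := le_csInf ⟨t₀, ht₀⟩ fun t ht => by
        linarith [(abs_le.1 (h s hs t ht)).2]
      linarith
  have hle' := (hP' hs₀).1.trans (hP' hs₀).2
  calc volume P + volume Q
      ≤ volume (Set.Icc (sSup Q - D) (sInf Q + D)) + volume (Set.Icc (sInf Q) (sSup Q)) := by
        gcongr
    _ = ENNReal.ofReal (2 * D) := by
        rw [Real.volume_Icc, Real.volume_Icc, ← ENNReal.ofReal_add (by linarith) (by linarith)]
        congr 1
        ring

section Steiner

variable {ι : Type*}

/-- The (open) Steiner symmetrization of `K` in the `i`-th coordinate direction. -/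
def steiner (i : ι) (K : Set (ι → ℝ)) : Set (ι → ℝ) :=
  {x | ENNReal.ofReal (2 * |x i|) < volume {t : ℝ | Function.update x i t ∈ K}}

/-- Reflection in the `i`-th coordinate hyperplane. -/
def coordFlip (i : ι) (x : ι → ℝ) : ι → ℝ := Function.update x i (-x i)

theorem flip_mem_steiner_self {i : ι} {K : Set (ι → ℝ)} {x : ι → ℝ} (hx : x ∈ steiner i K) :
    coordFlip i x ∈ steiner i K := by
  simpa [coordFlip, steiner] using hx

theorem flip_mem_steiner {i k : ι} {K : Set (ι → ℝ)} (hK : ∀ x ∈ K, coordFlip k x ∈ K)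
    {x : ι → ℝ} (hx : x ∈ steiner i K) : coordFlip k x ∈ steiner i K := by
  by_cases hki : k = i
  · exact hki ▸ flip_mem_steiner_self (hki ▸ hx)
  · have hx' : ENNReal.ofReal (2 * |x i|) < volume {t : ℝ | Function.update x i t ∈ K} := hx
    have hval : coordFlip k x i = x i := by simp [coordFlip, Ne.symm hki]
    change ENNReal.ofReal (2 * |coordFlip k x i|) < _
    rw [hval]
    refine hx'.trans_le (measure_mono fun t ht => ?_)
    have := hK _ ht
    simp only [Set.mem_ofPred_eq]
    rw [coordFlip, Function.update_comm hki]
    simpa [coordFlip, hki] using this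

theorem measurable_volume_slice (i : ι) {K : Set (ι → ℝ)} (hK : MeasurableSet K) :
    Measurable fun x : ι → ℝ => volume {t : ℝ | Function.update x i t ∈ K} := by
  have h := (measurable_one.indicator hK : Measurable (K.indicator (1 : (ι → ℝ) → ℝ≥0∞))).lmarginal
    (fun _ => (volume : Measure ℝ)) (s := {i})
  rw [lmarginal_singleton] at h
  convert h using 2 with x
  exact (lintegral_indicator_one (hK.preimage (measurable_update x))).symm

theorem measurableSet_steiner (i : ι) {K : Set (ι → ℝ)} (hK : MeasurableSet K) :
    MeasurableSet (steiner i K) := by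
  refine measurableSet_lt ?_ (measurable_volume_slice i hK)
  fun_prop

theorem volume_setOf_two_mul_abs_lt (m : ℝ≥0∞) :
    volume {t : ℝ | ENNReal.ofReal (2 * |t|) < m} = m := by
  rcases eq_or_ne m ⊤ with rfl | hm
  · simp only [ENNReal.ofReal_lt_top, Set.ofPred_true, Real.volume_univ]
  · have : {t : ℝ | ENNReal.ofReal (2 * |t|) < m} = Set.Ioo (-(m.toReal / 2)) (m.toReal / 2) := by
      ext t
      rw [Set.mem_ofPred_eq, ENNReal.ofReal_lt_iff_lt_toReal (by positivity) hm, Set.mem_Ioo,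
        ← abs_lt]
      constructor <;> intro h <;> linarith
    rw [this, Real.volume_Ioo]
    ring_nf
    exact ENNReal.ofReal_toReal hm

variable [Fintype ι]

theorem volume_steiner (i : ι) {K : Set (ι → ℝ)} (hK : MeasurableSet K) :
    volume (steiner i K) = volume K := by
  have hS := measurableSet_steiner i hK
  rw [← lintegral_indicator_one hK, ← lintegral_indicator_one hS, volume_pi]
  refine lintegral_eq_of_lmarginal_eq {i} (measurable_one.indicator hS)
    (measurable_one.indicator hK) ?_
  rw [lmarginal_singleton, lmarginal_singleton]
  ext x
  have h1 := lintegral_indicator_one (μ := volume) (hK.preimage (measurable_update x (a := i)))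
  have h2 := lintegral_indicator_one (μ := volume) (hS.preimage (measurable_update x (a := i)))
  refine h2.trans (Eq.trans ?_ h1.symm)
  have : Function.update x i ⁻¹' steiner i K =
      {t : ℝ | ENNReal.ofReal (2 * |t|) < volume (Function.update x i ⁻¹' K)} := by
    ext t
    simp [steiner, Set.preimage]
  rw [this, volume_setOf_two_mul_abs_lt]

theorem sum_sq_sub_le_of_mem_steiner {i : ι} {K : Set (ι → ℝ)} {d : ℝ}
    (hK : ∀ x ∈ K, ∀ y ∈ K, ∑ k, (x k - y k) ^ 2 ≤ d)
    {x y : ι → ℝ} (hx : x ∈ steiner i K) (hy : y ∈ steiner i K) :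
    ∑ k, (x k - y k) ^ 2 ≤ d := by
  obtain ⟨s, hs, t, ht, hst⟩ : ∃ s, Function.update x i s ∈ K ∧ ∃ t, Function.update y i t ∈ K ∧
      |x i - y i| < |s - t| := by
    by_contra! hcon
    have hP : {t : ℝ | Function.update x i t ∈ K}.Nonempty :=
      nonempty_of_measure_ne_zero (hx.trans_le' bot_le).ne'
    have hQ : {t : ℝ | Function.update y i t ∈ K}.Nonempty :=
      nonempty_of_measure_ne_zero (hy.trans_le' bot_le).ne'
    have h1 := volume_add_volume_le_of_dist_le hP hQ fun s hs t ht => hcon s hs t ht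
    have h2 := (ENNReal.add_lt_add hx hy).trans_le h1
    rw [← ENNReal.ofReal_add (by positivity) (by positivity)] at h2
    have h3 := (ENNReal.ofReal_lt_ofReal_iff_of_nonneg (by positivity)).1 h2
    linarith [abs_sub (x i) (y i)]
  refine le_trans (Finset.sum_le_sum fun k _ => ?_) (hK _ hs _ ht)
  by_cases hk : k = i
  · subst hk
    simpa using sq_le_sq.2 hst.le
  · simp [hk]

theorem exists_flip_invariant {K : Set (ι → ℝ)} (hK : MeasurableSet K) {d : ℝ}
    (hd : ∀ x ∈ K, ∀ y ∈ K, ∑ k, (x k - y k) ^ 2 ≤ d) (s : Finset ι) :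
    ∃ S : Set (ι → ℝ), MeasurableSet S ∧ volume S = volume K ∧
      (∀ x ∈ S, ∀ y ∈ S, ∑ k, (x k - y k) ^ 2 ≤ d) ∧ ∀ i ∈ s, ∀ x ∈ S, coordFlip i x ∈ S := by
  induction s using Finset.induction_on with
  | empty => exact ⟨K, hK, rfl, hd, by simp⟩
  | insert i s _ ih =>
    obtain ⟨S, hS, hvol, hdiam, hflip⟩ := ih
    refine ⟨steiner i S, measurableSet_steiner i hS, (volume_steiner i hS).trans hvol,
      fun x hx y hy => sum_sq_sub_le_of_mem_steiner hdiam hx hy, fun k hk x hx => ?_⟩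
    rcases Finset.mem_insert.1 hk with rfl | hk
    · exact flip_mem_steiner_self hx
    · exact flip_mem_steiner (hflip k hk) hx

theorem neg_mem_of_flip {S : Set (ι → ℝ)} (hS : ∀ i, ∀ x ∈ S, coordFlip i x ∈ S) {x : ι → ℝ}
    (hx : x ∈ S) : -x ∈ S := by
  have key : ∀ s : Finset ι, (fun k => if k ∈ s then -x k else x k) ∈ S := by
    intro s
    induction s using Finset.induction_on with
    | empty => simpa using hx
    | insert i s hi ih =>
      convert hS i _ ih using 1
      ext k
      by_cases hk : k = i
      · subst hk; simp [coordFlip, hi]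
      · simp [coordFlip, hk]
  convert key Finset.univ using 1
  ext k
  simp

theorem volume_le_volume_ball_of_diam {K : Set (ι → ℝ)} (hK : MeasurableSet K) {d : ℝ}
    (hd : ∀ x ∈ K, ∀ y ∈ K, ∑ k, (x k - y k) ^ 2 ≤ d ^ 2) :
    volume K ≤ volume {x : ι → ℝ | ∑ k, x k ^ 2 ≤ (d / 2) ^ 2} := by
  obtain ⟨S, -, hvol, hdiam, hflip⟩ := exists_flip_invariant hK hd Finset.univ
  rw [← hvol]
  refine measure_mono fun x hx => ?_
  have h := hdiam x hx _ (neg_mem_of_flip (fun i => hflip i (Finset.mem_univ i)) hx)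
  have : ∑ k, (x k - (-x) k) ^ 2 = 4 * ∑ k, x k ^ 2 := by
    rw [Finset.mul_sum]
    exact Finset.sum_congr rfl fun k _ => by simp only [Pi.neg_apply]; ring
  rw [this] at h
  simp only [Set.mem_ofPred_eq]
  linarith

end Steiner

/-- The isodiametric inequality in Euclidean space. -/
theorem volume_le_volume_closedBall_of_dist_le {j : ℕ} {K : Set (EuclideanSpace ℝ (Fin j))}
    {d : ℝ} (hd0 : 0 ≤ d) (hd : ∀ x ∈ K, ∀ y ∈ K, dist x y ≤ d) :
    volume K ≤ volume (closedBall (0 : EuclideanSpace ℝ (Fin j)) (d / 2)) := by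
  have hd' : ∀ x ∈ closure K, ∀ y ∈ closure K, dist x y ≤ d := fun x hx y hy =>
    isClosed_Iic.closure_subset (map_mem_closure₂ continuous_dist hx hy hd)
  have hpres := PiLp.volume_preserving_toLp (Fin j)
  have hm : MeasurableSet (closure K) := isClosed_closure.measurableSet
  have key := volume_le_volume_ball_of_diam (hpres.measurable hm) (d := d) fun x hx y hy => by
    have := hd' _ hx _ hy
    rw [EuclideanSpace.dist_eq] at this
    simpa [Real.dist_eq, sq_abs] using (Real.sqrt_le_left hd0).1 this
  calc volume K ≤ volume (closure K) := measure_mono subset_closure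
    _ = volume (WithLp.toLp 2 ⁻¹' closure K) := (hpres.measure_preimage hm.nullMeasurableSet).symm
    _ ≤ _ := key
    _ = volume (WithLp.toLp 2 ⁻¹' closedBall (0 : EuclideanSpace ℝ (Fin j)) (d / 2)) := by
        congr 1
        ext x
        simp [EuclideanSpace.norm_eq, Real.sqrt_le_left (show 0 ≤ d / 2 by positivity)]
    _ = _ := hpres.measure_preimage measurableSet_closedBall.nullMeasurableSet

variable {n j : ℕ}

theorem packPre_image_le {M : ℝ≥0} (hM : 0 < M) {U : Set (EuclideanSpace ℝ (Fin j))} {d η : ℝ}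
    (hd0 : 0 ≤ d) (hη : 0 < η) (hd : ∀ x ∈ U, ∀ y ∈ U, dist x y ≤ d)
    {g : EuclideanSpace ℝ (Fin j) → EuclideanSpace ℝ (Fin n)} (hg : LipschitzOnWith M g U) :
    packPre j η (g '' U) ≤ ENNReal.ofReal (M * d + 2 * η) ^ j := by
  have hM' : (0 : ℝ) < M := hM
  refine iSup₂_le fun D hD => ?_
  obtain ⟨hcount, hmem, hdisj⟩ := hD
  have : Countable D := hcount.to_subtype
  choose! c hcU hcg using fun p : D => (hmem p.1 p.2).1
  set ω := volume (closedBall (0 : EuclideanSpace ℝ (Fin j)) 1)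
  have hω0 : ω ≠ 0 := (measure_closedBall_pos _ _ one_pos).ne'
  have hωt : ω ≠ ⊤ := measure_closedBall_lt_top.ne
  have hvol : ∀ (x : EuclideanSpace ℝ (Fin j)) {r : ℝ}, 0 ≤ r →
      volume (closedBall x r) = ENNReal.ofReal r ^ j * ω := fun x r hr => by
    rw [Measure.addHaar_closedBall' _ _ hr, ENNReal.ofReal_pow hr, finrank_euclideanSpace_fin]
  have hdisj' : Pairwise (Function.onFun Disjoint fun p : D => closedBall (c p) (p.1.2 / M)) := by
    intro p q hpq
    have hp := (hmem p.1 p.2).2.1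
    have hq := (hmem q.1 q.2).2.1
    have h : Disjoint (closedBall p.1.1 p.1.2) (closedBall q.1.1 q.1.2) :=
      hdisj p.2 q.2 (fun h => hpq (Subtype.ext h))
    rw [disjoint_closedBall_closedBall_iff hp.le hq.le, ← hcg p, ← hcg q] at h
    rw [Function.onFun, disjoint_closedBall_closedBall_iff (by positivity) (by positivity),
      ← add_div, div_lt_iff₀' hM']
    exact h.trans_le (hg.dist_le_mul _ (hcU p) _ (hcU q))
  have hunion : volume (⋃ p : D, closedBall (c p) (p.1.2 / M)) ≤
      ENNReal.ofReal ((d + 2 * (η / M)) / 2) ^ j * ω := by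
    rw [← hvol 0 (by positivity)]
    refine volume_le_volume_closedBall_of_dist_le (by positivity) fun x hx y hy => ?_
    obtain ⟨p, hp⟩ := mem_iUnion.1 hx
    obtain ⟨q, hq⟩ := mem_iUnion.1 hy
    have h1 : dist x (c p) ≤ η / M :=
      (mem_closedBall.1 hp).trans (by gcongr; exact (hmem p.1 p.2).2.2)
    have h2 : dist y (c q) ≤ η / M :=
      (mem_closedBall.1 hq).trans (by gcongr; exact (hmem q.1 q.2).2.2)
    have h3 := hd _ (hcU p) _ (hcU q)
    have h4 := dist_triangle4 x (c p) (c q) y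
    rw [dist_comm (c q) y] at h4
    linarith
  rw [measure_iUnion hdisj' fun _ => measurableSet_closedBall] at hunion
  have hsum : ∑' p : D, volume (closedBall (c p) (p.1.2 / M)) =
      (∑' p : D, ENNReal.ofReal (p.1.2 / M) ^ j) * ω := by
    rw [← ENNReal.tsum_mul_right]
    exact tsum_congr fun p => hvol _ (div_nonneg (hmem p.1 p.2).2.1.le hM'.le)
  rw [hsum, ENNReal.mul_le_mul_iff_left hω0 hωt] at hunion
  calc ∑' p : D, ENNReal.ofReal (Metric.diam (closedBall p.1.1 p.1.2)) ^ j
      ≤ ∑' p : D, ENNReal.ofReal (2 * M) ^ j * ENNReal.ofReal (p.1.2 / M) ^ j := by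
        refine ENNReal.tsum_le_tsum fun p => ?_
        rw [← mul_pow, ← ENNReal.ofReal_mul (by positivity)]
        gcongr
        refine (diam_closedBall (hmem p.1 p.2).2.1.le).trans (le_of_eq ?_)
        field_simp
    _ = ENNReal.ofReal (2 * M) ^ j * ∑' p : D, ENNReal.ofReal (p.1.2 / M) ^ j :=
        ENNReal.tsum_mul_left
    _ ≤ ENNReal.ofReal (2 * M) ^ j * ENNReal.ofReal ((d + 2 * (η / M)) / 2) ^ j := by gcongr
    _ = ENNReal.ofReal (M * d + 2 * η) ^ j := by
        rw [← mul_pow, ← ENNReal.ofReal_mul (by positivity)]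
        congr 2
        field_simp

theorem packPre0_image_le {M : ℝ≥0} (hM : 0 < M) {U : Set (EuclideanSpace ℝ (Fin j))} {d : ℝ}
    (hd0 : 0 ≤ d) (hd : ∀ x ∈ U, ∀ y ∈ U, dist x y ≤ d)
    {g : EuclideanSpace ℝ (Fin j) → EuclideanSpace ℝ (Fin n)} (hg : LipschitzOnWith M g U) :
    packPre0 j (g '' U) ≤ ENNReal.ofReal (M * d) ^ j := by
  have hcont : Continuous fun η : ℝ => ENNReal.ofReal (M * d + 2 * η) ^ j :=
    (ENNReal.continuous_pow j).comp (ENNReal.continuous_ofReal.comp (by fun_prop))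
  have hlim := (hcont.tendsto 0).mono_left (nhdsWithin_le_nhds (s := Set.Ioi 0))
  rw [mul_zero, add_zero] at hlim
  refine ge_of_tendsto hlim ?_
  filter_upwards [self_mem_nhdsWithin] with η hη
  exact (iInf₂_le η hη).trans (packPre_image_le hM hd0 hη hd hg)

theorem packPre0_empty (s : ℕ) : packPre0 s (∅ : Set (EuclideanSpace ℝ (Fin n))) = 0 := by
  refine le_antisymm ((iInf₂_le 1 one_pos).trans (iSup₂_le fun D hD => ?_)) bot_le
  have : IsEmpty D := ⟨fun p => (hD.2.1 p.1 p.2).1⟩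
  simp

/-- The packing measure as an outer measure. -/
def packOuter (n s : ℕ) : OuterMeasure (EuclideanSpace ℝ (Fin n)) :=
  OuterMeasure.ofFunction (packPre0 s) (packPre0_empty s)

theorem packOuter_apply (s : ℕ) (E : Set (EuclideanSpace ℝ (Fin n))) :
    packOuter n s E = packMeasure s E :=
  OuterMeasure.ofFunction_apply _ _ _

theorem packMeasure_image_le {M : ℝ≥0} (hM : 0 < M) {S : Set (EuclideanSpace ℝ (Fin j))}
    {g : EuclideanSpace ℝ (Fin j) → EuclideanSpace ℝ (Fin n)} (hg : LipschitzOnWith M g S) :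
    packMeasure j (g '' S) ≤ (M : ℝ≥0∞) ^ j * μH[(j : ℝ)] S := by
  have hM0 : (M : ℝ≥0∞) ^ j ≠ 0 := pow_ne_zero _ (by exact_mod_cast hM.ne')
  have hMt : (M : ℝ≥0∞) ^ j ≠ ⊤ := ENNReal.pow_ne_top ENNReal.coe_ne_top
  rw [← ENNReal.div_le_iff' hM0 hMt, Measure.hausdorffMeasure_apply]
  refine le_trans ?_ (le_iSup₂ (1 : ℝ≥0∞) one_pos)
  refine le_iInf fun t => le_iInf₂ fun hts htd => ?_
  rw [ENNReal.div_le_iff' hM0 hMt, ← ENNReal.tsum_mul_left]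
  have hcover : g '' S ⊆ ⋃ i, g '' (S ∩ t i) := by
    rw [← image_iUnion, ← inter_iUnion, inter_eq_left.2 hts]
  refine (iInf₂_le (fun i => g '' (S ∩ t i)) hcover).trans (ENNReal.tsum_le_tsum fun i => ?_)
  rcases (t i).eq_empty_or_nonempty with h | h
  · simp [h, packPre0_empty]
  · have hfin : ediam (t i) ≠ ⊤ := ((htd i).trans_lt ENNReal.one_lt_top).ne
    have := packPre0_image_le hM (d := Metric.diam (t i)) Metric.diam_nonneg
      (fun x hx y hy => Metric.dist_le_diam_of_mem' hfin hx.2 hy.2)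
      (hg.mono (inter_subset_left (t := t i)))
    rw [ENNReal.ofReal_mul M.coe_nonneg, mul_pow] at this
    simpa [h, Metric.diam, ENNReal.ofReal_toReal hfin, ENNReal.rpow_natCast] using this

theorem packMeasure_le_of_bilipschitz {M : ℝ≥0} (hM : 0 < M) {E : Set (EuclideanSpace ℝ (Fin n))}
    {φ : EuclideanSpace ℝ (Fin n) → EuclideanSpace ℝ (Fin j)} (hφ : LipschitzOnWith M φ E)
    (hφ' : ∀ x ∈ E, ∀ y ∈ E, dist x y ≤ M * dist (φ x) (φ y)) :
    packMeasure j E ≤ (M : ℝ≥0∞) ^ j * ((M : ℝ≥0∞) ^ j * μH[(j : ℝ)] E) := by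
  have hinj : InjOn φ E := fun x hx y hy hxy => by
    have := hφ' x hx y hy
    rw [hxy, dist_self, mul_zero] at this
    exact dist_le_zero.1 this
  have hleft := hinj.leftInvOn_invFunOn
  have hlip : LipschitzOnWith M (Function.invFunOn φ E) (φ '' E) := by
    refine LipschitzOnWith.of_dist_le_mul ?_
    rintro _ ⟨x, hx, rfl⟩ _ ⟨y, hy, rfl⟩
    rw [hleft hx, hleft hy]
    exact hφ' x hx y hy
  have h := packMeasure_image_le hM hlip
  rw [hleft.image_image] at h
  refine h.trans (mul_le_mul_right ?_ _)
  simpa [ENNReal.rpow_natCast] using hφ.hausdorffMeasure_image_le (d := j) (by positivity)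

theorem IsPacking.mono {η : ℝ} {E F : Set (EuclideanSpace ℝ (Fin n))} (h : E ⊆ F)
    {D : Set (EuclideanSpace ℝ (Fin n) × ℝ)} (hD : IsPacking η E D) : IsPacking η F D :=
  ⟨hD.1, fun p hp => ⟨h (hD.2.1 p hp).1, (hD.2.1 p hp).2⟩, hD.2.2⟩

theorem packPre0_mono (s : ℕ) {E F : Set (EuclideanSpace ℝ (Fin n))} (h : E ⊆ F) :
    packPre0 s E ≤ packPre0 s F :=
  iInf₂_mono fun _ _ => iSup_mono fun _ => iSup_mono' fun hD => ⟨hD.mono h, le_rfl⟩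

theorem exists_isPacking_ae_cover (s : ℕ) {K : ℕ → Set (EuclideanSpace ℝ (Fin n))}
    (hK : ∀ i, μH[(s : ℝ)] (K i) < ⊤) {F : Set (EuclideanSpace ℝ (Fin n))} (hF : F ⊆ ⋃ i, K i)
    {η : ℝ} (hη : 0 < η) :
    ∃ D, IsPacking η F D ∧ μH[(s : ℝ)] (F \ ⋃ p : D, closedBall p.1.1 p.1.2) = 0 := by
  have (i : ℕ) : IsFiniteMeasure ((μH[(s : ℝ)] : Measure _).restrict (K i)) := ⟨by simpa using hK i⟩
  obtain ⟨t, r, htc, htF, hr, hnull, hdisj⟩ := Besicovitch.exists_disjoint_closedBall_covering_ae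
    (Measure.sum fun i => (μH[(s : ℝ)] : Measure _).restrict (K i)) (fun _ => Set.univ) F
    (fun x _ δ hδ => ⟨δ / 2, mem_univ _, by constructor <;> linarith⟩) (fun _ => η) (fun _ _ => hη)
  refine ⟨(fun x => (x, r x)) '' t, ⟨htc.image _, ?_, ?_⟩, ?_⟩
  · rintro _ ⟨x, hx, rfl⟩
    exact ⟨htF hx, (hr x hx).2.1, (hr x hx).2.2.le⟩
  · rintro _ ⟨x, hx, rfl⟩ _ ⟨y, hy, rfl⟩ hxy
    exact hdisj hx hy fun h => hxy (by rw [h])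
  · have hU : (⋃ p : (fun x => (x, r x)) '' t, closedBall p.1.1 p.1.2) =
        ⋃ x ∈ t, closedBall x (r x) := by
      ext z
      simp
    rw [hU]
    have hcov : F \ ⋃ x ∈ t, closedBall x (r x) ⊆
        ⋃ i, (F \ ⋃ x ∈ t, closedBall x (r x)) ∩ K i := by
      rw [← inter_iUnion]
      exact subset_inter subset_rfl (sdiff_subset.trans hF)
    refine measure_mono_null hcov (measure_iUnion_null fun i => ?_)
    refine le_antisymm ((Measure.le_restrict_apply _ _).trans ?_) bot_le
    rw [← hnull]
    exact Measure.le_iff'.1 (Measure.le_sum _ i) _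

theorem hausdorffMeasure_le_packPre0 (s : ℕ) {K : ℕ → Set (EuclideanSpace ℝ (Fin n))}
    (hK : ∀ i, μH[(s : ℝ)] (K i) < ⊤) {F : Set (EuclideanSpace ℝ (Fin n))} (hF : F ⊆ ⋃ i, K i) :
    μH[(s : ℝ)] F ≤ packPre0 s F := by
  refine le_iInf₂ fun η hη => ?_
  choose D hD hnull using fun m : ℕ => exists_isPacking_ae_cover s hK hF
    (show 0 < η / (m + 1) by positivity)
  have (m : ℕ) : Countable (D m) := (hD m).1.to_subtype
  set G := F ∩ ⋂ m, ⋃ p : D m, closedBall p.1.1 p.1.2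
  have hG : μH[(s : ℝ)] F ≤ μH[(s : ℝ)] G := by
    have hsub : F ⊆ G ∪ ⋃ m, F \ ⋃ p : D m, closedBall p.1.1 p.1.2 := by
      intro x hx
      by_cases h : ∀ m, x ∈ ⋃ p : D m, closedBall p.1.1 p.1.2
      · exact Or.inl ⟨hx, mem_iInter.2 h⟩
      · push Not at h
        obtain ⟨m, hm⟩ := h
        exact Or.inr (mem_iUnion.2 ⟨m, hx, hm⟩)
    refine (measure_mono hsub).trans ((measure_union_le _ _).trans ?_)
    rw [measure_iUnion_null hnull, add_zero]
  refine hG.trans ?_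
  have hlim : Filter.Tendsto (fun m : ℕ => ENNReal.ofReal (2 * (η / (m + 1)))) Filter.atTop
      (nhds 0) := by
    have h := (tendsto_one_div_add_atTop_nhds_zero_nat (𝕜 := ℝ)).const_mul (2 * η)
    rw [mul_zero] at h
    have h' := ENNReal.tendsto_ofReal h
    rw [ENNReal.ofReal_zero] at h'
    exact h'.congr fun m => by ring_nf
  have hdiam : ∀ (m : ℕ) (p : D m), ediam (closedBall p.1.1 p.1.2) =
      ENNReal.ofReal (Metric.diam (closedBall p.1.1 p.1.2)) := fun m p => by
    rw [Metric.diam, ENNReal.ofReal_toReal isBounded_closedBall.ediam_ne_top]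
  refine (Measure.hausdorffMeasure_le_liminf_tsum (s : ℝ) G
    (fun m : ℕ => ENNReal.ofReal (2 * (η / (m + 1)))) hlim
    (fun m (p : D m) => closedBall p.1.1 p.1.2) (Filter.Eventually.of_forall fun m p => ?_)
    (Filter.Eventually.of_forall fun m => inter_subset_right.trans (iInter_subset _ m))).trans ?_
  · have hp := ((hD m).2.1 p.1 p.2).2
    rw [hdiam]
    exact ENNReal.ofReal_le_ofReal ((diam_closedBall hp.1.le).trans (by linarith [hp.2]))
  · refine (Filter.liminf_le_liminf (Filter.Eventually.of_forall fun m => ?_)).trans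
      (Filter.liminf_const (packPre s η F)).le
    simp_rw [hdiam, ENNReal.rpow_natCast]
    refine le_iSup₂_of_le (D m) ⟨(hD m).1, fun p hp => ?_, (hD m).2.2⟩ le_rfl
    obtain ⟨h1, h2, h3⟩ := (hD m).2.1 p hp
    exact ⟨h1, h2, h3.trans (div_le_self hη.le (by linarith [m.cast_nonneg (α := ℝ)]))⟩

theorem hausdorffMeasure_le_packMeasure (s : ℕ) {K : ℕ → Set (EuclideanSpace ℝ (Fin n))}
    (hK : ∀ i, μH[(s : ℝ)] (K i) < ⊤) {A : Set (EuclideanSpace ℝ (Fin n))} (hA : A ⊆ ⋃ i, K i) :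
    μH[(s : ℝ)] A ≤ packMeasure s A := by
  refine le_iInf₂ fun F hF => ?_
  have hcov : A ⊆ ⋃ i, A ∩ F i := by
    rw [← inter_iUnion]
    exact subset_inter subset_rfl hF
  refine (measure_mono hcov).trans ((measure_iUnion_le _).trans (ENNReal.tsum_le_tsum fun i => ?_))
  exact (hausdorffMeasure_le_packPre0 s hK (inter_subset_left.trans hA)).trans
    (packPre0_mono s inter_subset_right)

theorem norm_orthogonalProjectionOnto_of_mem {V : Submodule ℝ (EuclideanSpace ℝ (Fin n))}
    {v : EuclideanSpace ℝ (Fin n)} (hv : v ∈ V) : ‖V.orthogonalProjectionOnto v‖ = ‖v‖ := by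
  lift v to V using hv
  rw [Submodule.orthogonalProjectionOnto_mem_subspace_eq_self, Submodule.norm_coe]

theorem exists_clm_norm_eq_norm_orthogonalProjection (V : Submodule ℝ (EuclideanSpace ℝ (Fin n)))
    (hV : Module.finrank ℝ V ≤ j) :
    ∃ Q : EuclideanSpace ℝ (Fin n) →L[ℝ] EuclideanSpace ℝ (Fin j),
      ∀ u, ‖Q u‖ = ‖V.orthogonalProjectionOnto u‖ := by
  let b := stdOrthonormalBasis ℝ V
  let e : Fin (Module.finrank ℝ V) → EuclideanSpace ℝ (Fin j) :=
    EuclideanSpace.basisFun (Fin j) ℝ ∘ Fin.castLE hV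
  have he : Orthonormal ℝ e :=
    (EuclideanSpace.basisFun (Fin j) ℝ).orthonormal.comp _ (Fin.castLE_injective hV)
  let T : V →ₗᵢ[ℝ] EuclideanSpace ℝ (Fin j) :=
    (b.toBasis.constr ℝ e).isometryOfOrthonormal (v := b.toBasis) (by simp)
      (by
        convert he using 1
        ext1 i
        simp)
  exact ⟨T.toContinuousLinearMap ∘L V.orthogonalProjectionOnto, fun u => T.norm_map _⟩

/-- Every point `y` of `A` has a radius and a linear map to `ℝʲ` that does not shrink the
increments `z - y` of nearby points `z` of `A` by more than the factor `c`. -/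
def LocallyExpanded (c : ℝ) (j : ℕ) (A : Set (EuclideanSpace ℝ (Fin n))) : Prop :=
  ∀ y ∈ A, ∃ ρ > (0 : ℝ), ∃ L : EuclideanSpace ℝ (Fin n) →L[ℝ] EuclideanSpace ℝ (Fin j),
    ∀ z ∈ A, dist z y ≤ ρ → c * ‖z - y‖ ≤ ‖L (z - y)‖

theorem mul_norm_sub_le_of_mem_closure {c : ℝ} {S : Set (EuclideanSpace ℝ (Fin n))}
    {L : EuclideanSpace ℝ (Fin n) →L[ℝ] EuclideanSpace ℝ (Fin j)}
    (h : ∀ z ∈ S, ∀ y ∈ S, c * ‖z - y‖ ≤ ‖L (z - y)‖) :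
    ∀ z ∈ closure S, ∀ y ∈ closure S, c * ‖z - y‖ ≤ ‖L (z - y)‖ := by
  have hclosed : IsClosed {v : EuclideanSpace ℝ (Fin n) | c * ‖v‖ ≤ ‖L v‖} :=
    isClosed_le (continuous_const.mul continuous_norm) L.continuous.norm
  intro z hz y hy
  have hmem := map_mem_closure₂ (u := {v | c * ‖v‖ ≤ ‖L v‖}) continuous_sub hz hy h
  rwa [hclosed.closure_eq] at hmem

theorem LocallyExpanded.exists_compact_cover {c : ℝ} (hc : 0 < c)
    {A : Set (EuclideanSpace ℝ (Fin n))} (hA : LocallyExpanded c j A) :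
    ∃ (K : ℕ → Set (EuclideanSpace ℝ (Fin n)))
      (L : ℕ → EuclideanSpace ℝ (Fin n) →L[ℝ] EuclideanSpace ℝ (Fin j)),
      (∀ i, IsCompact (K i)) ∧
      (∀ i, ∀ z ∈ K i, ∀ y ∈ K i, c / 2 * ‖z - y‖ ≤ ‖L i (z - y)‖) ∧ A ⊆ ⋃ i, K i := by
  choose! ρ hρ L hL using hA
  let Λ := TopologicalSpace.denseSeq (EuclideanSpace ℝ (Fin n) →L[ℝ] EuclideanSpace ℝ (Fin j))
  let q := TopologicalSpace.denseSeq (EuclideanSpace ℝ (Fin n))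
  let P : ℕ × ℕ × ℕ → Set (EuclideanSpace ℝ (Fin n)) := fun a =>
    {y ∈ A | dist (Λ a.1) (L y) < c / 2 ∧ 1 / ((a.2.1 : ℝ) + 1) < ρ y ∧
      dist (q a.2.2) y < 1 / ((a.2.1 : ℝ) + 1) / 2}
  obtain ⟨φ, hφ⟩ := exists_surjective_nat (ℕ × ℕ × ℕ)
  refine ⟨fun i => closure (P (φ i)), fun i => Λ (φ i).1, fun i => ?_, fun i => ?_, ?_⟩
  · exact ((isBounded_closedBall (x := q (φ i).2.2) (r := 1 / (((φ i).2.1 : ℝ) + 1) / 2)).subset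
      fun y hy => mem_closedBall'.2 hy.2.2.2.le).isCompact_closure
  · refine mul_norm_sub_le_of_mem_closure ?_
    rintro z ⟨hzA, -, -, hzq⟩ y ⟨hyA, hyL, hyρ, hyq⟩
    have h1 := hL y hyA z hzA (by linarith [dist_triangle_left z y (q (φ i).2.2)])
    have h2 : ‖(L y - Λ (φ i).1) (z - y)‖ ≤ c / 2 * ‖z - y‖ := by
      refine (ContinuousLinearMap.le_opNorm _ _).trans ?_
      gcongr
      rw [← dist_eq_norm, dist_comm]
      exact hyL.le
    have h3 := norm_sub_norm_le (L y (z - y)) (Λ (φ i).1 (z - y))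
    rw [sub_apply] at h2
    linarith
  · intro y hy
    obtain ⟨a, ha⟩ := (TopologicalSpace.denseRange_denseSeq _).exists_dist_lt (L y)
      (show 0 < c / 2 by positivity)
    obtain ⟨k, hk⟩ := exists_nat_one_div_lt (hρ y hy)
    obtain ⟨m, hm⟩ := (TopologicalSpace.denseRange_denseSeq _).exists_dist_lt y
      (show 0 < 1 / ((k : ℝ) + 1) / 2 by positivity)
    obtain ⟨i, hi⟩ := hφ (a, k, m)
    refine mem_iUnion.2 ⟨i, subset_closure ?_⟩
    rw [hi]
    exact ⟨hy, by rwa [dist_comm], hk, by rwa [dist_comm]⟩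

section Expanded

variable {c : ℝ} {B : Set (EuclideanSpace ℝ (Fin n))}
  {L : EuclideanSpace ℝ (Fin n) →L[ℝ] EuclideanSpace ℝ (Fin j)}

theorem exists_lipschitzOnWith_leftInvOn (hc : 0 < c)
    (hL : ∀ z ∈ B, ∀ y ∈ B, c * ‖z - y‖ ≤ ‖L (z - y)‖) :
    ∃ f : EuclideanSpace ℝ (Fin j) → EuclideanSpace ℝ (Fin n),
      LipschitzOnWith (Real.toNNReal c⁻¹) f (L '' B) ∧ LeftInvOn f L B := by
  have hinj : InjOn L B := fun x hx y hy hxy => by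
    have h := hL x hx y hy
    rw [map_sub, hxy, sub_self, norm_zero] at h
    exact sub_eq_zero.1 (norm_le_zero_iff.1 (nonpos_of_mul_nonpos_right h hc))
  have hleft := hinj.leftInvOn_invFunOn
  refine ⟨Function.invFunOn L B, LipschitzOnWith.of_dist_le_mul ?_, hleft⟩
  rintro _ ⟨x, hx, rfl⟩ _ ⟨y, hy, rfl⟩
  rw [hleft hx, hleft hy, Real.coe_toNNReal _ (inv_pos.2 hc).le, dist_eq_norm, dist_eq_norm,
    ← map_sub, ← div_eq_inv_mul, le_div_iff₀' hc]
  exact hL x hx y hy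

theorem isAddHaarMeasure_hausdorffMeasure_euclideanSpace (j : ℕ) :
    (μH[(j : ℝ)] : Measure (EuclideanSpace ℝ (Fin j))).IsAddHaarMeasure := by
  simpa using isAddHaarMeasure_hausdorffMeasure (E := EuclideanSpace ℝ (Fin j))

theorem hausdorffMeasure_lt_top_of_expanded (hc : 0 < c) (hB : Bornology.IsBounded B)
    (hL : ∀ z ∈ B, ∀ y ∈ B, c * ‖z - y‖ ≤ ‖L (z - y)‖) : μH[(j : ℝ)] B < ⊤ := by
  obtain ⟨f, hf, hleft⟩ := exists_lipschitzOnWith_leftInvOn hc hL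
  have := isAddHaarMeasure_hausdorffMeasure_euclideanSpace j
  have h := hf.hausdorffMeasure_image_le (d := j) (by positivity)
  rw [hleft.image_image] at h
  refine h.trans_lt (ENNReal.mul_lt_top ?_ (L.lipschitz.isBounded_image hB).measure_lt_top)
  exact ENNReal.rpow_lt_top_of_nonneg (by positivity) ENNReal.coe_ne_top

theorem packMeasure_le_of_approximatesLinearOn {M : ℝ≥0} (hM : 1 < M)
    {f : EuclideanSpace ℝ (Fin j) → EuclideanSpace ℝ (Fin n)} (hleft : LeftInvOn f L B)
    {T : EuclideanSpace ℝ (Fin j) →L[ℝ] EuclideanSpace ℝ (Fin n)} {δ : ℝ≥0}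
    (hT : ApproximatesLinearOn f T (L '' B) δ) (hδ : δ * ‖L‖ ≤ 1 - (M : ℝ)⁻¹) :
    packMeasure j B ≤ (M : ℝ≥0∞) ^ j * ((M : ℝ≥0∞) ^ j * μH[(j : ℝ)] B) := by
  have hM1 : (1 : ℝ) < M := hM
  obtain ⟨Q, hQ⟩ := exists_clm_norm_eq_norm_orthogonalProjection (j := j)
    (LinearMap.range T.toLinearMap) ((LinearMap.finrank_range_le _).trans (by simp))
  have hQT : ∀ u, ‖Q (T u)‖ = ‖T u‖ := fun u => by
    have hu : T u ∈ LinearMap.range T.toLinearMap := ⟨u, rfl⟩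
    rw [hQ, norm_orthogonalProjectionOnto_of_mem hu]
  have key : ∀ x ∈ B, ∀ y ∈ B, ‖x - y - T (L x - L y)‖ ≤ (1 - (M : ℝ)⁻¹) * ‖x - y‖ := by
    intro x hx y hy
    have h := hT _ (mem_image_of_mem L hx) _ (mem_image_of_mem L hy)
    rw [hleft hx, hleft hy] at h
    refine h.trans ?_
    rw [← map_sub]
    calc (δ : ℝ) * ‖L (x - y)‖ ≤ δ * (‖L‖ * ‖x - y‖) := by gcongr; exact L.le_opNorm _
      _ ≤ _ := by rw [← mul_assoc]; gcongr
  have hdist : ∀ x y, dist (Q (T (L x))) (Q (T (L y))) = ‖T (L x - L y)‖ := fun x y => by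
    rw [dist_eq_norm, ← map_sub, ← map_sub, hQT]
  refine packMeasure_le_of_bilipschitz (φ := fun x => Q (T (L x))) (zero_lt_one.trans hM)
    (LipschitzOnWith.of_dist_le_mul fun x hx y hy => ?_) fun x hx y hy => ?_
  · rw [hdist, dist_eq_norm]
    have h1 := norm_sub_norm_le (T (L x - L y)) (x - y)
    rw [norm_sub_rev (T (L x - L y)) (x - y)] at h1
    have h2 := key x hx y hy
    have h3 : 2 - (M : ℝ)⁻¹ ≤ M := by
      have : (M : ℝ) * (M : ℝ)⁻¹ = 1 := mul_inv_cancel₀ (by positivity)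
      nlinarith [sq_nonneg ((M : ℝ) - 1), inv_pos.2 (zero_lt_one.trans hM1)]
    nlinarith [norm_nonneg (x - y)]
  · rw [hdist, dist_eq_norm]
    have h1 := norm_sub_norm_le (x - y) (T (L x - L y))
    have h2 := key x hx y hy
    have h3 : (M : ℝ)⁻¹ * ‖x - y‖ ≤ ‖T (L x - L y)‖ := by linarith
    rwa [← div_eq_inv_mul, div_le_iff₀' (by positivity)] at h3

theorem packMeasure_le_mul_hausdorffMeasure_of_expanded (hc : 0 < c)
    (hL : ∀ z ∈ B, ∀ y ∈ B, c * ‖z - y‖ ≤ ‖L (z - y)‖) {M : ℝ≥0} (hM : 1 < M) :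
    packMeasure j B ≤ (M : ℝ≥0∞) ^ j * ((M : ℝ≥0∞) ^ j * μH[(j : ℝ)] B) := by
  obtain ⟨f, hf, hleft⟩ := exists_lipschitzOnWith_leftInvOn hc hL
  have := isAddHaarMeasure_hausdorffMeasure_euclideanSpace j
  have hM1 : (1 : ℝ) < M := hM
  set δ : ℝ := (1 - (M : ℝ)⁻¹) / (‖L‖ + 1)
  have hδ : 0 < δ := div_pos (sub_pos.2 (inv_lt_one_of_one_lt₀ hM1)) (by positivity)
  have hδL : δ * ‖L‖ ≤ 1 - (M : ℝ)⁻¹ := by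
    have : δ * (‖L‖ + 1) = 1 - (M : ℝ)⁻¹ := div_mul_cancel₀ _ (by positivity)
    linarith
  let D : Set (EuclideanSpace ℝ (Fin j)) := {x | x ∈ L '' B → DifferentiableWithinAt ℝ f (L '' B) x}
  have hD : μH[(j : ℝ)] Dᶜ = 0 := hf.ae_differentiableWithinAt_of_mem (μ := μH[(j : ℝ)])
  set N := toMeasurable μH[(j : ℝ)] Dᶜ
  have hN0 : μH[(j : ℝ)] N = 0 := (measure_toMeasurable _).trans hD
  have hNm : MeasurableSet N := measurableSet_toMeasurable _ _
  obtain ⟨t, T, htd, htm, htc, htT, -⟩ := exists_partition_approximatesLinearOn_of_hasFDerivWithinAt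
    f (L '' B \ N) (fun x => fderivWithin ℝ f (L '' B) x) (fun x hx => by
      have hxD : x ∈ D := by
        by_contra h
        exact hx.2 (subset_toMeasurable _ _ h)
      exact (hxD hx.1).hasFDerivWithinAt.mono sdiff_subset)
    (fun _ => δ.toNNReal) (fun _ => (Real.toNNReal_pos.2 hδ).ne')
  have himage : ∀ i, L '' (B ∩ L ⁻¹' (t i \ N)) = (L '' B \ N) ∩ t i := fun i => by
    rw [image_inter_preimage]
    ext x
    simp only [mem_inter_iff, mem_sdiff]
    tauto
  have hpiece : ∀ i, packMeasure j (B ∩ L ⁻¹' (t i \ N)) ≤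
      (M : ℝ≥0∞) ^ j * ((M : ℝ≥0∞) ^ j * μH[(j : ℝ)] (B ∩ L ⁻¹' (t i \ N))) := fun i => by
    refine packMeasure_le_of_approximatesLinearOn hM (hleft.mono inter_subset_left)
      (himage i ▸ htT i) ?_
    rwa [Real.coe_toNNReal _ hδ.le]
  have hnull : packMeasure j (B ∩ L ⁻¹' N) = 0 := by
    have hle := packMeasure_image_le (M := Real.toNNReal c⁻¹) (Real.toNNReal_pos.2 (inv_pos.2 hc))
      (hf.mono (image_mono (inter_subset_left (t := L ⁻¹' N))))
    rw [(hleft.mono inter_subset_left).image_image, image_inter_preimage,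
      measure_mono_null inter_subset_right hN0, mul_zero] at hle
    exact le_antisymm hle bot_le
  have hcover : B ⊆ (B ∩ L ⁻¹' N) ∪ ⋃ i, B ∩ L ⁻¹' (t i \ N) := by
    intro x hx
    by_cases hxN : L x ∈ N
    · exact Or.inl ⟨hx, hxN⟩
    · obtain ⟨i, hi⟩ := mem_iUnion.1 (htc ⟨mem_image_of_mem L hx, hxN⟩)
      exact Or.inr (mem_iUnion.2 ⟨i, hx, hi, hxN⟩)
  have hsum : ∑' i, μH[(j : ℝ)] (B ∩ L ⁻¹' (t i \ N)) ≤ μH[(j : ℝ)] B := by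
    have hm : ∀ i, MeasurableSet (L ⁻¹' (t i \ N)) := fun i =>
      L.continuous.measurable ((htm i).diff hNm)
    have hd : Pairwise (Function.onFun Disjoint fun i => L ⁻¹' (t i \ N)) := fun i k hik =>
      ((htd hik).mono sdiff_subset sdiff_subset).preimage _
    calc ∑' i, μH[(j : ℝ)] (B ∩ L ⁻¹' (t i \ N))
        = ∑' i, (μH[(j : ℝ)] : Measure _).restrict B (L ⁻¹' (t i \ N)) :=
          tsum_congr fun i => by rw [Measure.restrict_apply (hm i), inter_comm]
      _ = (μH[(j : ℝ)] : Measure _).restrict B (⋃ i, L ⁻¹' (t i \ N)) := (measure_iUnion hd hm).symm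
      _ ≤ (μH[(j : ℝ)] : Measure _).restrict B Set.univ := measure_mono (subset_univ _)
      _ = μH[(j : ℝ)] B := Measure.restrict_apply_univ _
  simp only [← packOuter_apply] at hpiece hnull ⊢
  calc packOuter n j B
      ≤ packOuter n j (B ∩ L ⁻¹' N) + packOuter n j (⋃ i, B ∩ L ⁻¹' (t i \ N)) :=
        (measure_mono hcover).trans (measure_union_le _ _)
    _ ≤ ∑' i, packOuter n j (B ∩ L ⁻¹' (t i \ N)) := by
        rw [hnull, zero_add]
        exact measure_iUnion_le _
    _ ≤ ∑' i, (M : ℝ≥0∞) ^ j * ((M : ℝ≥0∞) ^ j * μH[(j : ℝ)] (B ∩ L ⁻¹' (t i \ N))) :=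
        ENNReal.tsum_le_tsum hpiece
    _ ≤ _ := by
        rw [ENNReal.tsum_mul_left, ENNReal.tsum_mul_left]
        gcongr

theorem packMeasure_le_hausdorffMeasure_of_expanded (hc : 0 < c)
    (hL : ∀ z ∈ B, ∀ y ∈ B, c * ‖z - y‖ ≤ ‖L (z - y)‖) :
    packMeasure j B ≤ μH[(j : ℝ)] B := by
  have hcoe : Filter.Tendsto (fun M : ℝ≥0 => (M : ℝ≥0∞) ^ j) (nhdsWithin 1 (Set.Ioi 1))
      (nhds 1) := by
    have h := ((ENNReal.continuous_pow j).comp ENNReal.continuous_coe).tendsto (1 : ℝ≥0)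
    simp only [Function.comp_apply, ENNReal.coe_one, one_pow] at h
    exact h.mono_left nhdsWithin_le_nhds
  have hlim := ENNReal.Tendsto.mul hcoe (Or.inl one_ne_zero)
    (ENNReal.Tendsto.mul_const (b := μH[(j : ℝ)] B) hcoe (Or.inl one_ne_zero))
    (Or.inr ENNReal.one_ne_top)
  rw [one_mul, one_mul] at hlim
  refine ge_of_tendsto hlim ?_
  filter_upwards [self_mem_nhdsWithin] with M hM
  exact packMeasure_le_mul_hausdorffMeasure_of_expanded hc hL hM

end Expanded

theorem LocallyExpanded.packMeasure_eq_hausdorffMeasure {c : ℝ} (hc : 0 < c)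
    {A : Set (EuclideanSpace ℝ (Fin n))} (hA : LocallyExpanded c j A) :
    packMeasure j A = μH[(j : ℝ)] A := by
  obtain ⟨K, L, hK, hL, hcov⟩ := hA.exists_compact_cover hc
  have hc2 : 0 < c / 2 := by positivity
  refine le_antisymm ?_ (hausdorffMeasure_le_packMeasure j
    (fun i => hausdorffMeasure_lt_top_of_expanded hc2 (hK i).isBounded (hL i)) hcov)
  have hcov' : A ⊆ ⋃ i, A ∩ disjointed K i := by
    rw [← inter_iUnion, iUnion_disjointed]
    exact subset_inter subset_rfl hcov
  have hm : ∀ i, MeasurableSet (disjointed K i) :=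
    fun i => MeasurableSet.disjointed (fun i => (hK i).measurableSet) i
  calc packMeasure j A = packOuter n j A := (packOuter_apply _ _).symm
    _ ≤ ∑' i, packOuter n j (A ∩ disjointed K i) :=
        (measure_mono hcov').trans (measure_iUnion_le _)
    _ ≤ ∑' i, μH[(j : ℝ)] (A ∩ disjointed K i) := ENNReal.tsum_le_tsum fun i => by
        rw [packOuter_apply]
        exact packMeasure_le_hausdorffMeasure_of_expanded hc2 fun z hz y hy =>
          hL i z (disjointed_subset K i hz.2) y (disjointed_subset K i hy.2)
    _ = ∑' i, (μH[(j : ℝ)] : Measure _).restrict A (disjointed K i) :=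
        tsum_congr fun i => by rw [Measure.restrict_apply (hm i), inter_comm]
    _ = (μH[(j : ℝ)] : Measure _).restrict A (⋃ i, disjointed K i) :=
        (measure_iUnion (disjoint_disjointed K) hm).symm
    _ ≤ μH[(j : ℝ)] A := (measure_mono (subset_univ _)).trans (Measure.restrict_apply_univ _).le


theorem norm_sub_orthogonalProjectionOnto_le_of_mem_nbhd {r : ℝ}
    {W : Submodule ℝ (EuclideanSpace ℝ (Fin n))} {y z : EuclideanSpace ℝ (Fin n)}
    (h : z ∈ nbhd (affPlane y W) r) : ‖z - y - W.orthogonalProjectionOnto (z - y)‖ ≤ r := by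
  refine ((le_infDist ⟨y, by simp [affPlane]⟩).2 fun w hw => ?_).trans h
  have hmin := W.starProjection_minimal (z - y)
  rw [Submodule.starProjection_apply] at hmin
  rw [hmin]
  refine (ciInf_le ⟨0, by rintro _ ⟨_, rfl⟩; positivity⟩ (⟨w - y, hw⟩ : W)).trans_eq ?_
  rw [sub_sub_sub_cancel_right, dist_eq_norm]

theorem RsEmpty.locallyExpanded {δ : ℝ} {A : Set (EuclideanSpace ℝ (Fin n))}
    (hA : RsEmpty j δ A) : LocallyExpanded (1 - δ) j A := by
  intro y hy
  obtain ⟨ρ, hρ, W, hW, h⟩ := hA y hy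
  obtain ⟨Q, hQ⟩ := exists_clm_norm_eq_norm_orthogonalProjection W hW.le
  refine ⟨ρ, hρ, Q, fun z hz hzy => ?_⟩
  rw [dist_eq_norm] at hzy
  obtain hzero | hpos := (norm_nonneg (z - y)).eq_or_lt
  · rw [← hzero, mul_zero]
    exact norm_nonneg _
  have h1 := norm_sub_orthogonalProjectionOnto_le_of_mem_nbhd
    (h ‖z - y‖ ⟨hpos, hzy⟩ ⟨mem_closedBall_iff_norm.2 le_rfl, hz⟩)
  have h2 := norm_sub_norm_le (z - y)
    (W.orthogonalProjectionOnto (z - y) : EuclideanSpace ℝ (Fin n))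
  rw [Submodule.norm_coe] at h2
  rw [hQ]
  linarith

theorem RsRho.rsEmpty {δ : ℝ} {A : Set (EuclideanSpace ℝ (Fin n))} (hA : RsRho j δ A) :
    RsEmpty j δ A := fun y hy => by
  obtain ⟨ρ, hρ, W, hW, h⟩ := hA y hy
  exact ⟨ρ, hρ, W, hW, h y ⟨mem_closedBall_self hρ.le, hy⟩⟩

theorem RsRho0.rsEmpty {δ : ℝ} {A : Set (EuclideanSpace ℝ (Fin n))} (hA : RsRho0 j δ A) :
    RsEmpty j δ A := fun y hy => by
  obtain ⟨ρ, hρ, -, W, hW, h⟩ := hA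
  exact ⟨ρ, hρ, W, hW, h y hy⟩

theorem RDelta.rsEmpty {β : Beta} {δ : ℝ} {A : Set (EuclideanSpace ℝ (Fin n))}
    (hA : RDelta .s β j δ A) : RsEmpty j δ A :=
  match β, hA with
  | .none, h => h
  | .rho, h => RsRho.rsEmpty h
  | .rho0, h => RsRho0.rsEmpty h

theorem finrank_span_le_of_approximated {S : Set (EuclideanSpace ℝ (Fin n))}
    (hS : ∀ ε > (0 : ℝ), ∃ W : Submodule ℝ (EuclideanSpace ℝ (Fin n)), Module.finrank ℝ W = j ∧
      ∀ v ∈ S, ‖v - W.orthogonalProjectionOnto v‖ < ε) :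
    Module.finrank ℝ (Submodule.span ℝ S) ≤ j := by
  obtain ⟨f, hfS, -, hf⟩ := Submodule.exists_fun_fin_finrank_span_eq ℝ S
  obtain ⟨ε, hε, hball⟩ := Metric.eventually_nhds_iff.1 hf.eventually
  obtain ⟨W, hW, hWS⟩ := hS ε hε
  have hg := hball (y := fun i => (W.orthogonalProjectionOnto (f i) : EuclideanSpace ℝ (Fin n)))
    ((dist_pi_lt_iff hε).2 fun i => by rw [dist_comm, dist_eq_norm]; exact hWS _ (hfS i))
  have hg' : LinearIndependent ℝ fun i => W.orthogonalProjectionOnto (f i) :=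
    LinearIndependent.of_comp W.subtype hg
  simpa [hW] using hg'.fintype_card_le_finrank

theorem locallyExpanded_of_forall_rwRho0 {A : Set (EuclideanSpace ℝ (Fin n))}
    (hA : ∀ δ ∈ Set.Ioo (0 : ℝ) 1, RwRho0 j δ A) : LocallyExpanded 1 j A := by
  obtain hsub | ⟨a, ha, b, hb, hab⟩ := A.subsingleton_or_nontrivial
  · refine fun y hy => ⟨1, one_pos, 0, fun z hz _ => ?_⟩
    simp [hsub hz hy]
  intro y hy
  set r := dist a b / 2 with hr
  have hr0 : 0 < r := half_pos (dist_pos.2 hab)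
  set S := {v | ∃ z ∈ A, dist z y ≤ r ∧ z - y = v}
  have hrank : Module.finrank ℝ (Submodule.span ℝ S) ≤ j :=
    finrank_span_le_of_approximated fun ε hε => by
      obtain ⟨δ, hδ0, hδ⟩ := exists_between (lt_min one_pos (div_pos hε hr0))
      obtain ⟨hδ1, hδε⟩ := lt_min_iff.1 hδ
      obtain ⟨ρ, hρ, ⟨c, hc⟩, h⟩ := hA δ ⟨hδ0, hδ1⟩
      have hrρ : r ≤ ρ := by
        linarith [dist_triangle_right a b c, mem_closedBall.1 (hc ha), mem_closedBall.1 (hc hb)]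
      obtain ⟨W, hW, hWA⟩ := h y hy r ⟨hr0, hrρ⟩
      refine ⟨W, hW, ?_⟩
      rintro _ ⟨z, hz, hzy, rfl⟩
      exact (norm_sub_orthogonalProjectionOnto_le_of_mem_nbhd
        (hWA ⟨mem_closedBall.2 hzy, hz⟩)).trans_lt ((lt_div_iff₀ hr0).1 hδε)
  obtain ⟨Q, hQ⟩ := exists_clm_norm_eq_norm_orthogonalProjection _ hrank
  refine ⟨r, hr0, Q, fun z hz hzy => ?_⟩
  have hmem : z - y ∈ Submodule.span ℝ S := Submodule.subset_span ⟨z, hz, hzy, rfl⟩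
  rw [one_mul, hQ, norm_orthogonalProjectionOnto_of_mem hmem]

/-- for a set with the `ρ0`-uniform fine weak property or any strong
Reifenberg property, the `j`-dimensional packing and Hausdorff measures coincide. -/
theorem pack_eq_hausdorff (n j : ℕ) (hj : j ≤ n) (A : Set (EuclideanSpace ℝ (Fin n)))
    (hA : RGamma .w .rho0 j Option.none A ∨
      ∃ (β : Beta) (γ : Option ℝ), memDelta γ ∧ RGamma .s β j γ A) :
    packMeasure j A = μH[(j : ℝ)] A := by
  obtain hw | ⟨β, γ, rfl | ⟨δ, hδ, rfl⟩, hs⟩ := hA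
  · exact (locallyExpanded_of_forall_rwRho0 hw).packMeasure_eq_hausdorffMeasure one_pos
  · have h : RDelta .s β j (1 / 2) A := hs (1 / 2) (by norm_num)
    exact h.rsEmpty.locallyExpanded.packMeasure_eq_hausdorffMeasure (by norm_num)
  · have h : RDelta .s β j δ A := hs
    exact h.rsEmpty.locallyExpanded.packMeasure_eq_hausdorffMeasure (sub_pos.2 hδ.2)

end ReifenbergPaper
end
end
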